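/- arXiv:math/0507180 — 2 statements merged into one kernel-verified Lean document; each statement's English description precedes it below -/
import Mathlib

section
/- If α(1 ∧ β) > 1, then there is no distribution P in the class P_Σ = P_Σ(α, C0, β, L, c0, r0, μ_min, μ_max, C) (for any choice of the parameters C0, c0, r0, μ_min, μ_max and compact C ⊂ R^d) such that the regression function η associated with P crosses the level 1/2 at a point in the interior of the support of P_X. Conversely, for any α, β > 0 with α(1 ∧ β) ≤ 1, any integer d ≥ 1, any L > 0 and any compact C ⊂ R^d with nonempty interior, there exist parameters C0 > 0, c0 > 0, r0 > 0, 0 < μ_min < μ_max < ∞ and a distribution P ∈ P_Σ(α, C0, β, L, c0, r0, μ_min, μ_max, C) whose regression function crosses the level 1/2 at a point in the interior of the support of P_X. -/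
open MeasureTheory Metric Set
open scoped ENNReal NNReal

noncomputable section

/-- Feature space: `ℝ^d` with the Euclidean norm. -/
abbrev Euc (d : ℕ) := EuclideanSpace ℝ (Fin d)

/-- A sample of size `n`: `n` points of `ℝ^d × {0,1}` (labels modelled by `Bool`). -/
abbrev Sample (d n : ℕ) := Fin n → Euc d × Bool

/-- Joint law of `(X,Y)` determined by the marginal `PX` and the regression
function `η(x) = P(Y = 1 | X = x)`. -/
def jointLaw {d : ℕ} (PX : Measure (Euc d)) (η : Euc d → ℝ) : Measure (Euc d × Bool) :=
  PX.bind fun x =>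
    ENNReal.ofReal (η x) • Measure.dirac (x, true) +
      ENNReal.ofReal (1 - η x) • Measure.dirac (x, false)

/-- Law `P^{⊗n}` of an i.i.d. sample of size `n`. -/
def sampleLaw {d : ℕ} (PX : Measure (Euc d)) (η : Euc d → ℝ) (n : ℕ) :
    Measure (Sample d n) :=
  Measure.pi fun _ => jointLaw PX η

/-- Misclassification risk `R(f) = P(Y ≠ f(X))` of a decision rule `f`. -/
def risk {d : ℕ} (PX : Measure (Euc d)) (η : Euc d → ℝ) (f : Euc d → Bool) : ℝ :=
  ∫ x, (if f x then 1 - η x else η x) ∂PX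

/-- The Bayes rule `f*(x) = 1{η(x) ≥ 1/2}`. -/
def bayes {d : ℕ} (η : Euc d → ℝ) : Euc d → Bool := fun x => decide ((1 : ℝ) / 2 ≤ η x)

/-- The plug-in rule `1{g ≥ 1/2}` associated with a function `g`. -/
def plugin {d : ℕ} (g : Euc d → ℝ) : Euc d → Bool := fun x => decide ((1 : ℝ) / 2 ≤ g x)

/-- Margin (low noise) assumption MA(α, C0):
`P_X(0 < |η(X) − 1/2| ≤ t) ≤ C0 t^α` for all `t > 0`. -/
def Margin {d : ℕ} (PX : Measure (Euc d)) (η : Euc d → ℝ) (α C0 : ℝ) : Prop :=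
  ∀ t : ℝ, 0 < t →
    PX {x | 0 < |η x - 1 / 2| ∧ |η x - 1 / 2| ≤ t} ≤ ENNReal.ofReal (C0 * t ^ α)

/-- Taylor polynomial of degree `N` of `g` at `x`, evaluated at `x'`. -/
def taylorPoly {d : ℕ} (g : Euc d → ℝ) (N : ℕ) (x x' : Euc d) : ℝ :=
  ∑ k ∈ Finset.range (N + 1), (k.factorial : ℝ)⁻¹ * iteratedFDeriv ℝ k g x (fun _ => x' - x)

/-- The Hölder class `Σ(β, L, ℝ^d)`: `g` is `⌊β⌋` times continuously differentiable
(`⌊β⌋` = largest integer strictly less than `β`, i.e. `⌈β⌉₊ - 1` for `β > 0`) and its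
Taylor polynomial of degree `⌊β⌋` approximates it to order `L‖x − x'‖^β`. -/
def HolderClass {d : ℕ} (β L : ℝ) (g : Euc d → ℝ) : Prop :=
  ContDiff ℝ (⌈β⌉₊ - 1 : ℕ) g ∧
    ∀ x x' : Euc d, |g x' - taylorPoly g (⌈β⌉₊ - 1) x x'| ≤ L * ‖x' - x‖ ^ β

/-- `(c0, r0)`-regularity of a set `A`:
`λ[A ∩ B(x,r)] ≥ c0 λ[B(x,r)]` for all `0 < r ≤ r0` and `x ∈ A`. -/
def Regular {d : ℕ} (c0 r0 : ℝ) (A : Set (Euc d)) : Prop :=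
  ∀ x ∈ A, ∀ r : ℝ, 0 < r → r ≤ r0 →
    ENNReal.ofReal c0 * volume (closedBall x r) ≤ volume (A ∩ closedBall x r)

/-- Strong density assumption with parameters `(c0, r0, μmin, μmax, K)`. -/
def StrongDensity {d : ℕ} (PX : Measure (Euc d)) (c0 r0 μmin μmax : ℝ)
    (K : Set (Euc d)) : Prop :=
  ∃ A : Set (Euc d), IsCompact A ∧ A ⊆ K ∧ Regular c0 r0 A ∧
    ∃ μ : Euc d → ℝ, Measurable μ ∧ (∀ x ∈ A, μmin ≤ μ x ∧ μ x ≤ μmax) ∧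
      (∀ x, x ∉ A → μ x = 0) ∧
      PX = volume.withDensity fun x => ENNReal.ofReal (μ x)

/-- Mild density assumption with parameters `(c0, r0, μmax, K)`. -/
def MildDensity {d : ℕ} (PX : Measure (Euc d)) (c0 r0 μmax : ℝ)
    (K : Set (Euc d)) : Prop :=
  ∃ A : Set (Euc d), IsCompact A ∧ A ⊆ K ∧ Regular c0 r0 A ∧
    ∃ μ : Euc d → ℝ, Measurable μ ∧ (∀ x ∈ A, 0 ≤ μ x ∧ μ x ≤ μmax) ∧
      (∀ x, x ∉ A → μ x = 0) ∧
      PX = volume.withDensity fun x => ENNReal.ofReal (μ x)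

/-- The class `P_Σ(α, C0, β, L, c0, r0, μmin, μmax, K)`, a distribution being encoded
by its marginal `PX` together with its regression function `η`. -/
def MemPS {d : ℕ} (α C0 β L c0 r0 μmin μmax : ℝ) (K : Set (Euc d))
    (PX : Measure (Euc d)) (η : Euc d → ℝ) : Prop :=
  IsProbabilityMeasure PX ∧ Measurable η ∧ (∀ x, η x ∈ Icc (0 : ℝ) 1) ∧
    Margin PX η α C0 ∧ HolderClass β L η ∧ StrongDensity PX c0 r0 μmin μmax K

/-- Topological support of a measure on `ℝ^d`. -/
def msupport {d : ℕ} (PX : Measure (Euc d)) : Set (Euc d) :=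
  {x | ∀ r : ℝ, 0 < r → 0 < PX (ball x r)}

/-- `f` hits the level `a` at `x0`. -/
def Hits {d : ℕ} (f : Euc d → ℝ) (a : ℝ) (x0 : Euc d) : Prop :=
  f x0 = a ∧ ∀ r : ℝ, 0 < r → ∃ x ∈ closedBall x0 r, f x ≠ a

/-- `f` crosses the level `a` at `x0`. -/
def Crosses {d : ℕ} (f : Euc d → ℝ) (a : ℝ) (x0 : Euc d) : Prop :=
  ∀ r : ℝ, 0 < r → (∃ x ∈ closedBall x0 r, f x < a) ∧ ∃ x ∈ closedBall x0 r, a < f x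

/-- Expected excess risk `E[R(f̂_n)] − R(f*)` of a plug-in classifier built from the
estimator `hatη` of the regression function. -/
def expExcess {d : ℕ} (PX : Measure (Euc d)) (η : Euc d → ℝ) {n : ℕ}
    (hatη : Sample d n → Euc d → ℝ) : ℝ :=
  (∫ ω, risk PX η (plugin (hatη ω)) ∂sampleLaw PX η n) - risk PX η (bayes η)

/-- Expected excess risk `E[R(f̂_n)] − R(f*)` of a (general) classifier. -/
def expExcessRule {d : ℕ} (PX : Measure (Euc d)) (η : Euc d → ℝ) {n : ℕ}
    (fhat : Sample d n → Euc d → Bool) : ℝ :=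
  (∫ ω, risk PX η (fhat ω) ∂sampleLaw PX η n) - risk PX η (bayes η)

/-- Empirical misclassification risk of the plug-in rule `1{g ≥ 1/2}` on a sample. -/
def empRisk {d n : ℕ} (ω : Sample d n) (g : Euc d → ℝ) : ℝ :=
  (n : ℝ)⁻¹ * ∑ i : Fin n, if plugin g (ω i).1 ≠ (ω i).2 then (1 : ℝ) else 0


lemma line_lower (f : ℝ → ℝ) (M γ t : ℝ) (hM : 0 < M) (hγ : 0 < γ) (ht : 0 < t)
    (hf : ContinuousOn f (Icc 0 1)) (h0 : f 0 < 0) (h1 : t ≤ f 1)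
    (hH : ∀ s ∈ Icc (0:ℝ) 1, ∀ s' ∈ Icc (0:ℝ) 1, |f s - f s'| ≤ M * |s - s'| ^ γ) :
    ENNReal.ofReal ((t / M) ^ (1 / γ)) ≤ volume {s : ℝ | s ∈ Icc (0:ℝ) 1 ∧ 0 < f s ∧ f s ≤ t} := by
  set Z : Set ℝ := Icc 0 1 ∩ f ⁻¹' Iic 0 with hZ
  have hZc : IsClosed Z := hf.preimage_isClosed_of_isClosed isClosed_Icc isClosed_Iic
  have hZne : Z.Nonempty := ⟨0, by simp [hZ, h0.le]⟩
  have hZb : BddAbove Z := ⟨1, fun s hs => hs.1.2⟩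
  set u := sSup Z with hu
  have huZ : u ∈ Z := hZc.csSup_mem hZne hZb
  have hpos : ∀ s ∈ Icc (0:ℝ) 1, u < s → 0 < f s := by
    intro s hs hus
    by_contra hc
    exact absurd (le_csSup hZb (show s ∈ Z from ⟨hs, not_lt.1 hc⟩)) (not_le.2 hus)
  have hfu : f u ≤ 0 := huZ.2
  have hbd : ∀ s ∈ Icc (0:ℝ) 1, u ≤ s → f s ≤ M * (s - u) ^ γ := by
    intro s hs hus
    have := hH s hs u huZ.1
    rw [abs_of_nonneg (sub_nonneg.2 hus)] at this
    linarith [le_abs_self (f s - f u)]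
  set δ := (t / M) ^ (1 / γ) with hδ
  have hδ0 : 0 ≤ δ := by positivity
  have hδγ : δ ^ γ = t / M := by
    rw [hδ, ← Real.rpow_mul (by positivity)]
    simp [hγ.ne']
  have hle : u + δ ≤ 1 := by
    have h2 := hbd 1 (by simp) huZ.1.2
    have h3 : δ ^ γ ≤ (1 - u) ^ γ := by
      rw [hδγ, div_le_iff₀ hM]; linarith
    have := (Real.rpow_le_rpow_iff hδ0 (sub_nonneg.2 huZ.1.2) hγ).1 h3
    linarith
  calc ENNReal.ofReal δ = volume (Ioc u (u + δ)) := by simp [Real.volume_Ioc]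
    _ ≤ _ := by
      apply measure_mono
      intro s hs
      have hs1 : s ∈ Icc (0:ℝ) 1 := ⟨huZ.1.1.trans hs.1.le, hs.2.trans hle⟩
      refine ⟨hs1, hpos s hs1 hs.1, (hbd s hs1 hs.1.le).trans ?_⟩
      have : (s - u) ^ γ ≤ δ ^ γ :=
        Real.rpow_le_rpow (sub_nonneg.2 hs.1.le) (by linarith [hs.2]) hγ.le
      rw [hδγ, le_div_iff₀ hM] at this
      linarith

lemma tube_lower {d : ℕ} (S : Set (Euc d)) (hS : MeasurableSet S) (x e : Euc d) (ρ : ℝ)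
    (δ : ℝ≥0∞)
    (h : ∀ y ∈ ball x ρ, δ ≤ volume {s : ℝ | s ∈ Icc (0:ℝ) 1 ∧ y + s • e ∈ S}) :
    δ * volume (ball x ρ) ≤ volume S := by
  set T : Set (Euc d × ℝ) := {p | p.1 ∈ ball x ρ ∧ p.2 ∈ Icc (0:ℝ) 1 ∧ p.1 + p.2 • e ∈ S} with hT
  have hTm : MeasurableSet T := by
    have hm : Measurable (fun p : Euc d × ℝ => p.1 + p.2 • e) := by fun_prop
    exact (measurable_fst measurableSet_ball).inter
      ((measurable_snd measurableSet_Icc).inter (hm hS))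
  have e1 : δ * volume (ball x ρ) ≤ (volume.prod volume) T := by
    rw [Measure.prod_apply hTm]
    calc δ * volume (ball x ρ) = ∫⁻ y in ball x ρ, δ := by simp
      _ ≤ ∫⁻ y in ball x ρ, volume (Prod.mk y ⁻¹' T) := by
        apply setLIntegral_mono' measurableSet_ball
        intro y hy
        refine (h y hy).trans (measure_mono ?_)
        intro s hs
        exact ⟨hy, hs⟩
      _ ≤ _ := setLIntegral_le_lintegral _ _
  have e2 : (volume.prod volume) T ≤ volume S := by
    rw [Measure.prod_apply_symm hTm]
    calc ∫⁻ s : ℝ, volume ((fun y => (y, s)) ⁻¹' T)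
        ≤ ∫⁻ s : ℝ, (Icc (0:ℝ) 1).indicator (fun _ => volume S) s := by
          apply lintegral_mono
          intro s
          by_cases hs : s ∈ Icc (0:ℝ) 1
          · simp only [indicator_of_mem hs]
            calc volume ((fun y => (y, s)) ⁻¹' T) ≤ volume ((fun y => y + s • e) ⁻¹' S) :=
                  measure_mono (fun y hy => hy.2.2)
              _ = volume S := measure_preimage_add_right _ _ _
          · have : (fun y : Euc d => (y, s)) ⁻¹' T = ∅ := by
              ext y; simp only [hT, mem_preimage, mem_ofPred_eq, mem_empty_iff_false, iff_false]
              exact fun hy => hs hy.2.1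
            simp [this]
      _ = volume S := by simp [lintegral_indicator measurableSet_Icc]
  exact e1.trans e2

lemma local_holder {d : ℕ} (β L : ℝ) (hβ : 0 < β) (hL : 0 < L) (η : Euc d → ℝ)
    (h : HolderClass β L η) (x0 : Euc d) :
    ∃ M > 0, ∃ R > 0, ∀ x ∈ ball x0 R, ∀ y ∈ ball x0 R,
      |η x - η y| ≤ M * ‖x - y‖ ^ (min 1 β) := by
  by_cases hb : β ≤ 1
  · refine ⟨L, hL, 1, one_pos, fun x _ y _ => ?_⟩
    have hN : ⌈β⌉₊ = 1 := by
      apply le_antisymm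
      · exact Nat.ceil_le.2 (by simpa using hb)
      · exact Nat.one_le_iff_ne_zero.2 (Nat.ceil_pos.2 hβ).ne'
    have := h.2 y x
    rw [hN] at this
    simpa [taylorPoly, min_eq_right hb] using this
  · push Not at hb
    have hc : ContDiff ℝ 1 η := by
      refine h.1.of_le ?_
      have : 2 ≤ ⌈β⌉₊ := Nat.lt_ceil.2 (by simpa using hb)
      exact_mod_cast (by omega : 1 ≤ ⌈β⌉₊ - 1)
    obtain ⟨Kc, s, hs, hl⟩ := hc.contDiffAt.exists_lipschitzOnWith (x := x0)
    obtain ⟨R, hR, hRs⟩ := Metric.mem_nhds_iff.1 hs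
    refine ⟨Kc + 1, by positivity, R, hR, fun x hx y hy => ?_⟩
    have := hl.dist_le_mul x (hRs hx) y (hRs hy)
    rw [Real.dist_eq, dist_eq_norm] at this
    rw [min_eq_left hb.le, Real.rpow_one]
    nlinarith [norm_nonneg (x - y)]

lemma part1 {d : ℕ} (α β L : ℝ) (hβ : 0 < β) (hL : 0 < L)
    (hab : (1 : ℝ) < α * min 1 β) (C0 c0 r0 μmin μmax : ℝ) (K' : Set (Euc d))
    (PX : Measure (Euc d)) (η : Euc d → ℝ) (x0 : Euc d) (hC0 : 0 < C0) (hμ : 0 < μmin)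
    (hP : MemPS α C0 β L c0 r0 μmin μmax K' PX η)
    (hx0 : x0 ∈ interior (msupport PX)) (hcr : Crosses η (1 / 2) x0) : False := by
  obtain ⟨-, hηm, -, hMA, hHol, A, hA, -, -, μ, hμm, hμA, hμ0, hPX⟩ := hP
  have hγ : 0 < min 1 β := lt_min one_pos hβ
  set γ := min 1 β with hγdef
  have hcont : Continuous η := hHol.1.continuous
  have hsub : msupport PX ⊆ A := by
    intro x hx
    by_contra hxA
    obtain ⟨r, hr, hrA⟩ := Metric.isOpen_iff.1 hA.isClosed.isOpen_compl x hxA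
    have := hx r hr
    rw [hPX, withDensity_apply _ measurableSet_ball] at this
    rw [setLIntegral_congr_fun measurableSet_ball (g := fun _ => 0)
      (fun y hy => by simp [hμ0 y (hrA hy)])] at this
    simp at this
  obtain ⟨M, hM, R1, hR1, hloc⟩ := local_holder β L hβ hL η hHol x0
  obtain ⟨R2, hR2, hRA⟩ := Metric.isOpen_iff.1 isOpen_interior x0 hx0
  set R := min R1 R2 with hR
  have hR0 : 0 < R := lt_min hR1 hR2
  obtain ⟨⟨xm, hxm, hxm'⟩, xp, hxp, hxp'⟩ := hcr (R / 4) (by positivity)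
  obtain ⟨m, hm0, hm⟩ := exists_between hxp'
  have o1 : IsOpen {x | η x < 1 / 2} := isOpen_lt hcont continuous_const
  have o2 : IsOpen {x | m < η x} := isOpen_lt continuous_const hcont
  obtain ⟨ρ1, hρ1, hb1⟩ := Metric.isOpen_iff.1 o1 xm hxm'
  obtain ⟨ρ2, hρ2, hb2⟩ := Metric.isOpen_iff.1 o2 xp hm
  set ρ := min (min ρ1 ρ2) (R / 4) with hρ
  have hρ0 : 0 < ρ := by positivity
  set e := xp - xm with he
  have hene : e ≠ 0 := by
    intro h0
    have : xp = xm := sub_eq_zero.1 h0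
    rw [this] at hxp'; linarith
  have heN : 0 < ‖e‖ := norm_pos_iff.2 hene
  have hin : ∀ y ∈ ball xm ρ, ∀ s ∈ Icc (0:ℝ) 1, y + s • e ∈ ball x0 R := by
    intro y hy s hs
    have h1 : ‖y - xm‖ < R / 4 := (mem_ball_iff_norm.1 hy).trans_le (min_le_right _ _)
    have h2 : ‖xm - x0‖ ≤ R / 4 := mem_closedBall_iff_norm.1 hxm
    have h3 : ‖xp - x0‖ ≤ R / 4 := mem_closedBall_iff_norm.1 hxp
    rw [mem_ball_iff_norm]
    have h4 : y + s • e - x0 = (y - xm) + (s • (xp - x0) + (1 - s) • (xm - x0)) := by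
      rw [he]; module
    rw [h4]
    have h5 : ‖s • (xp - x0)‖ ≤ R / 4 := by
      rw [norm_smul, Real.norm_of_nonneg hs.1]; nlinarith [hs.1, hs.2, norm_nonneg (xp - x0)]
    have h6 : ‖(1 - s) • (xm - x0)‖ ≤ R / 4 := by
      rw [norm_smul, Real.norm_of_nonneg (by linarith [hs.2])]
      nlinarith [hs.1, hs.2, norm_nonneg (xm - x0)]
    have := norm_add_le (y - xm) (s • (xp - x0) + (1 - s) • (xm - x0))
    have := norm_add_le (s • (xp - x0)) ((1 - s) • (xm - x0))
    linarith
  set M' := M * ‖e‖ ^ γ with hM'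
  have hM'0 : 0 < M' := by positivity
  set V := (volume (ball xm ρ)).toReal with hV
  have hV0 : 0 < V := ENNReal.toReal_pos (measure_ball_pos _ _ hρ0).ne' measure_ball_lt_top.ne
  have key : ∀ t, 0 < t → t ≤ m - 1 / 2 → μmin * ((t / M') ^ (1 / γ) * V) ≤ C0 * t ^ α := by
    intro t ht htm
    set S : Set (Euc d) := ball x0 R ∩ {x | 0 < η x - 1 / 2 ∧ η x - 1 / 2 ≤ t} with hSdef
    have hSm : MeasurableSet S := by
      refine measurableSet_ball.inter (MeasurableSet.inter ?_ ?_)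
      · exact measurableSet_lt measurable_const (hηm.sub_const _)
      · exact measurableSet_le (hηm.sub_const _) measurable_const
    have hvol := tube_lower S hSm xm e ρ (ENNReal.ofReal ((t / M') ^ (1 / γ))) (by
      intro y hy
      refine (line_lower (fun s => η (y + s • e) - 1 / 2) M' γ t hM'0 hγ ht ?_ ?_ ?_ ?_).trans
        (measure_mono ?_)
      · fun_prop
      · have : y ∈ ball xm ρ1 := ball_subset_ball ((min_le_left _ _).trans (min_le_left _ _)) hy
        have := hb1 this
        simp only [mem_ofPred_eq] at this
        simp only [zero_smul, add_zero]; linarith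
      · have : y + (1:ℝ) • e ∈ ball xp ρ2 := by
          have h1 : ‖y - xm‖ < ρ2 :=
            (mem_ball_iff_norm.1 hy).trans_le ((min_le_left _ _).trans (min_le_right _ _))
          rw [mem_ball_iff_norm]
          have h2 : y + (1:ℝ) • e - xp = y - xm := by rw [he]; module
          rwa [h2]
        have := hb2 this
        simp only [mem_ofPred_eq] at this
        linarith
      · intro s hs s' hs'
        have := hloc _ (ball_subset_ball (min_le_left _ _) (hin y hy s hs)) _
          (ball_subset_ball (min_le_left _ _) (hin y hy s' hs'))
        have h1 : y + s • e - (y + s' • e) = (s - s') • e := by module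
        rw [h1, norm_smul, Real.mul_rpow (norm_nonneg _) (norm_nonneg _), Real.norm_eq_abs] at this
        calc _ = |η (y + s • e) - η (y + s' • e)| := by congr 1; ring
          _ ≤ _ := this
          _ = _ := by rw [hM']; ring
      · intro s hs
        exact ⟨hs.1, hin y hy s hs.1, hs.2⟩)
    have hPS : ENNReal.ofReal μmin * volume S ≤ PX S := by
      rw [hPX, withDensity_apply _ hSm]
      calc _ = ∫⁻ x in S, ENNReal.ofReal μmin := by simp
        _ ≤ _ := by
          apply setLIntegral_mono' hSm
          intro x hx
          apply ENNReal.ofReal_le_ofReal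
          refine (hμA x (hsub (interior_subset (hRA ?_)))).1
          exact ball_subset_ball (min_le_right _ _) hx.1
    have hPS' : PX S ≤ ENNReal.ofReal (C0 * t ^ α) := by
      refine le_trans (measure_mono ?_) (hMA t ht)
      intro x hx
      have h1 := hx.2.1
      have h2 := hx.2.2
      exact ⟨abs_pos.2 h1.ne', by rw [abs_of_pos h1]; exact h2⟩
    have hall : ENNReal.ofReal (μmin * ((t / M') ^ (1 / γ) * V)) ≤ ENNReal.ofReal (C0 * t ^ α) := by
      rw [ENNReal.ofReal_mul hμ.le, ENNReal.ofReal_mul (by positivity), hV,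
        ENNReal.ofReal_toReal measure_ball_lt_top.ne]
      exact (mul_le_mul_right hvol _).trans (hPS.trans hPS')
    exact (ENNReal.ofReal_le_ofReal_iff (by positivity)).1 hall
  set c := μmin * (M' ^ (1 / γ))⁻¹ * V / C0 with hc
  have hc0 : 0 < c := by positivity
  have hexp : 0 < α - 1 / γ := by
    rw [sub_pos, div_lt_iff₀ hγ]; exact hab
  have key2 : ∀ t, 0 < t → t ≤ m - 1 / 2 → c ≤ t ^ (α - 1 / γ) := by
    intro t ht htm
    have h1 := key t ht htm
    rw [Real.div_rpow ht.le hM'0.le] at h1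
    rw [Real.rpow_sub ht, hc, div_le_div_iff₀ hC0 (by positivity)]
    calc _ = μmin * (t ^ (1 / γ) / M' ^ (1 / γ) * V) := by rw [div_eq_mul_inv]; ring
      _ ≤ _ := h1
      _ = _ := by ring
  have hlim : Filter.Tendsto (fun t : ℝ => t ^ (α - 1 / γ)) (nhdsWithin 0 (Ioi 0)) (nhds 0) := by
    have := (Real.continuousAt_rpow_const 0 (α - 1 / γ) (Or.inr hexp.le)).tendsto
    rw [Real.zero_rpow hexp.ne'] at this
    exact this.mono_left nhdsWithin_le_nhds
  have ev1 := hlim.eventually_lt_const hc0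
  have ev2 : ∀ᶠ t : ℝ in nhdsWithin 0 (Ioi 0), t ∈ Ioc 0 (m - 1 / 2) :=
    Ioc_mem_nhdsGT (by linarith)
  obtain ⟨t, h1, h2⟩ := (ev1.and ev2).exists
  exact absurd (key2 t h2.1 h2.2) (not_le.2 h1)

lemma regular_closedBall {d : ℕ} (a : Euc d) (R : ℝ) (hR : 0 < R) :
    Regular ((1 / 2 : ℝ) ^ d) R (closedBall a R) := by
  intro x hx r hr hrR
  set z := x + (r / (2 * R)) • (a - x) with hz
  have hx' : ‖x - a‖ ≤ R := mem_closedBall_iff_norm.1 hx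
  have hq0 : 0 ≤ r / (2 * R) := by positivity
  have hqR : r / (2 * R) * R = r / 2 := by field_simp
  have hq1 : r / (2 * R) ≤ 1 := by
    rw [div_le_one (by positivity)]; linarith
  have hzx : ‖z - x‖ ≤ r / 2 := by
    have : z - x = (r / (2 * R)) • (a - x) := by rw [hz]; module
    rw [this, norm_smul, Real.norm_of_nonneg hq0, norm_sub_rev, ← hqR]
    gcongr
  have hza : ‖z - a‖ ≤ R - r / 2 := by
    have : z - a = (1 - r / (2 * R)) • (x - a) := by rw [hz]; module
    rw [this, norm_smul, Real.norm_of_nonneg (by linarith)]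
    calc _ ≤ (1 - r / (2 * R)) * R := by gcongr
      _ = _ := by rw [sub_mul, hqR, one_mul]
  have hsub : closedBall z (r / 2) ⊆ closedBall a R ∩ closedBall x r := by
    apply subset_inter
    · apply closedBall_subset_closedBall'
      rw [dist_eq_norm]; linarith
    · apply closedBall_subset_closedBall'
      rw [dist_eq_norm]; linarith
  refine le_trans (le_of_eq ?_) (measure_mono hsub)
  rw [show r / 2 = (1 / 2) * r by ring, Measure.addHaar_closedBall_mul volume z (by norm_num) hr.le,
    Measure.addHaar_closedBall_center volume x]
  simp

lemma slab_volume {d : ℕ} (a : Euc d) (R : ℝ) (i : Fin d) (s : ℝ) :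
    volume (closedBall a R ∩ {x | |x i - a i| ≤ s}) ≤
      ENNReal.ofReal (2 * s) * ENNReal.ofReal (2 * R) ^ (d - 1) := by
  set w : Fin d → ℝ := fun j => if j = i then s else R with hw
  set B : Set (Fin d → ℝ) := Icc (fun j => a j - w j) (fun j => a j + w j) with hB
  have hsub : closedBall a R ∩ {x | |x i - a i| ≤ s} ⊆ (@WithLp.ofLp 2 (Fin d → ℝ)) ⁻¹' B := by
    rintro x ⟨hx, hxs⟩
    have hall : ∀ j, |x j - a j| ≤ w j := by
      intro j
      by_cases hj : j = i
      · subst hj; simpa [hw] using hxs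
      · have h1 := PiLp.norm_apply_le (x - a) j
        have h2 := mem_closedBall_iff_norm.1 hx
        simp only [PiLp.sub_apply, Real.norm_eq_abs] at h1
        simp only [hw, hj, if_false]
        exact h1.trans h2
    constructor
    · intro j; have := abs_le.1 (hall j); simp only; linarith
    · intro j; have := abs_le.1 (hall j); simp only; linarith
  refine (measure_mono hsub).trans ?_
  rw [(PiLp.volume_preserving_ofLp (Fin d)).measure_preimage measurableSet_Icc.nullMeasurableSet,
    Real.volume_Icc_pi, ← Finset.mul_prod_erase Finset.univ _ (Finset.mem_univ i)]
  apply le_of_eq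
  congr 1
  · simp only [hw, if_true]; congr 1; ring
  · rw [Finset.prod_congr rfl (g := fun _ => ENNReal.ofReal (2 * R))]
    · simp
    · intro j hj
      have : j ≠ i := Finset.ne_of_mem_erase hj
      simp only [hw, this, if_false]; congr 1; ring

lemma part2_core {d : ℕ} (α β L : ℝ) (hα : 0 < α) (hβ : 0 < β)
    (hab : α * min 1 β ≤ 1) (K : Set (Euc d)) (a : Euc d) (R : ℝ) (hR : 0 < R)
    (hRK : closedBall a R ⊆ K) (η : Euc d → ℝ) (hη01 : ∀ x, η x ∈ Icc (0:ℝ) 1)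
    (hH : HolderClass β L η) (i : Fin d) (m : ℝ) (hm : 0 < m)
    (hlow : ∀ x ∈ closedBall a R, m * |x i - a i| ^ (min 1 β) ≤ |η x - 1 / 2|)
    (hcr : Crosses η (1 / 2) a) :
    ∃ (C0 c0 r0 μmin μmax : ℝ) (PX : Measure (Euc d)) (η : Euc d → ℝ) (x0 : Euc d),
        0 < C0 ∧ 0 < c0 ∧ 0 < r0 ∧ 0 < μmin ∧ μmin < μmax ∧
        MemPS α C0 β L c0 r0 μmin μmax K PX η ∧
        x0 ∈ interior (msupport PX) ∧ Crosses η (1 / 2) x0 := by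
  have hγ : 0 < min 1 β := lt_min one_pos hβ
  set γ := min 1 β with hγdef
  set A := closedBall a R with hA
  have hAm : MeasurableSet A := measurableSet_closedBall
  have hAfin : volume A ≠ ∞ := measure_closedBall_lt_top.ne
  have hApos : 0 < volume A := measure_closedBall_pos _ _ hR
  set V := (volume A).toReal with hV
  have hV0 : 0 < V := ENNReal.toReal_pos hApos.ne' hAfin
  set μ : Euc d → ℝ := A.indicator (fun _ => V⁻¹) with hμ
  set PX : Measure (Euc d) := volume.withDensity fun x => ENNReal.ofReal (μ x) with hPX
  have hPX' : ∀ S, PX S = ENNReal.ofReal V⁻¹ * volume (A ∩ S) := by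
    intro S
    have : (fun x => ENNReal.ofReal (μ x)) = A.indicator (fun _ => ENNReal.ofReal V⁻¹) := by
      ext x
      by_cases hx : x ∈ A <;> simp [hμ, hx]
    rw [hPX, this, withDensity_indicator hAm, withDensity_const, Measure.smul_apply,
      Measure.restrict_apply' hAm, inter_comm, smul_eq_mul]
  have hprob : IsProbabilityMeasure PX := by
    constructor
    rw [hPX', inter_univ, hV, ENNReal.ofReal_inv_of_pos hV0, hV, ENNReal.ofReal_toReal hAfin]
    exact ENNReal.inv_mul_cancel hApos.ne' hAfin
  set C1 := V⁻¹ * (2 * (m⁻¹) ^ (1 / γ) * (2 * R) ^ (d - 1)) with hC1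
  refine ⟨max 1 C1, (1 / 2) ^ d, R, V⁻¹ / 2, V⁻¹, PX, η, a, by positivity, by positivity, hR,
    by positivity, half_lt_self (by positivity), ⟨hprob, hH.1.continuous.measurable, hη01, ?_, hH,
      A, isCompact_closedBall _ _, hRK, regular_closedBall a R hR, μ,
      measurable_const.indicator hAm, ?_, ?_, hPX⟩, ?_, hcr⟩
  · intro t ht
    rcases le_or_gt t 1 with ht1 | ht1
    · have hsub : A ∩ {x | 0 < |η x - 1 / 2| ∧ |η x - 1 / 2| ≤ t} ⊆
          closedBall a R ∩ {x | |x i - a i| ≤ (t * m⁻¹) ^ (1 / γ)} := by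
        rintro x ⟨hx, -, hxt⟩
        refine ⟨hx, ?_⟩
        have h1 : |x i - a i| ^ γ ≤ t * m⁻¹ := by
          rw [← div_eq_mul_inv, le_div_iff₀ hm]
          linarith [hlow x hx]
        have := Real.rpow_le_rpow (by positivity) h1 (by positivity : 0 ≤ 1 / γ)
        rwa [← Real.rpow_mul (abs_nonneg _), mul_one_div_cancel hγ.ne', Real.rpow_one] at this
      rw [hPX']
      calc _ ≤ ENNReal.ofReal V⁻¹ * (ENNReal.ofReal (2 * (t * m⁻¹) ^ (1 / γ)) *
              ENNReal.ofReal (2 * R) ^ (d - 1)) := by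
            gcongr
            exact (measure_mono hsub).trans (slab_volume a R i _)
        _ = ENNReal.ofReal (C1 * t ^ (1 / γ)) := by
            rw [← ENNReal.ofReal_pow (by positivity), ← ENNReal.ofReal_mul (by positivity),
              ← ENNReal.ofReal_mul (by positivity), Real.mul_rpow ht.le (by positivity), hC1]
            congr 1; ring
        _ ≤ _ := by
            apply ENNReal.ofReal_le_ofReal
            have : t ^ (1 / γ) ≤ t ^ α :=
              Real.rpow_le_rpow_of_exponent_ge ht ht1 (by rw [le_div_iff₀ hγ]; exact hab)
            gcongr
            exact le_max_right _ _
    · refine prob_le_one.trans ?_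
      rw [ENNReal.one_le_ofReal]
      exact one_le_mul_of_one_le_of_one_le (le_max_left _ _) (Real.one_le_rpow ht1.le hα.le)
  · intro x hx
    have : 0 < V⁻¹ := by positivity
    simp only [hμ, indicator_of_mem hx]
    exact ⟨by linarith, le_rfl⟩
  · intro x hx
    simp [hμ, hx]
  · refine mem_interior.2 ⟨ball a R, ?_, isOpen_ball, mem_ball_self hR⟩
    intro x hx r hr
    rw [hPX']
    apply ENNReal.mul_pos
    · simpa using hV0
    · have : 0 < volume (ball a R ∩ ball x r) :=
        (isOpen_ball.inter isOpen_ball).measure_pos volume ⟨x, hx, mem_ball_self hr⟩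
      exact (this.trans_le (measure_mono (inter_subset_inter_left _ ball_subset_closedBall))).ne'

lemma crosses_aux {d : ℕ} (a : Euc d) (i : Fin d) (η : Euc d → ℝ) (G : ℝ → ℝ)
    (hG : ∀ x, η x = G (x i - a i))
    (hpos : ∀ u, 0 < u → u ≤ 1 → 1 / 2 < G u) (hneg : ∀ u, 0 < u → u ≤ 1 → G (-u) < 1 / 2) :
    Crosses η (1 / 2) a := by
  intro r hr
  have hs : 0 < min r 1 := by positivity
  refine ⟨⟨a + EuclideanSpace.single i (-(min r 1)), ?_, ?_⟩,
    ⟨a + EuclideanSpace.single i (min r 1), ?_, ?_⟩⟩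
  · rw [mem_closedBall_iff_norm]; simp [abs_of_pos hs]
  · rw [hG]; simpa using hneg (min r 1) hs (min_le_right _ _)
  · rw [mem_closedBall_iff_norm]; simp [abs_of_pos hs]
  · rw [hG]; simpa using hpos (min r 1) hs (min_le_right _ _)

lemma rpow_holder (β : ℝ) (hβ : 0 < β) (hb : β ≤ 1) (x y : ℝ) (hx : 0 ≤ x) (hy : 0 ≤ y) :
    |x ^ β - y ^ β| ≤ |x - y| ^ β := by
  wlog h : y ≤ x generalizing x y
  · rw [abs_sub_comm, abs_sub_comm x y]; exact this y x hy hx (le_of_not_ge h)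
  rw [abs_of_nonneg (sub_nonneg.2 (Real.rpow_le_rpow hy h hβ.le)), abs_of_nonneg (sub_nonneg.2 h)]
  have := Real.rpow_add_le_add_rpow (sub_nonneg.2 h) hy hβ.le hb
  rw [sub_add_cancel] at this
  linarith

lemma part2_small {d : ℕ} (α β L : ℝ) (hα : 0 < α) (hβ : 0 < β) (hL : 0 < L) (hb : β ≤ 1)
    (hab : α * min 1 β ≤ 1) (K : Set (Euc d)) (a : Euc d) (R : ℝ) (hR : 0 < R) (hR1 : R ≤ 1)
    (hRK : closedBall a R ⊆ K) (i : Fin d) :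
    ∃ (C0 c0 r0 μmin μmax : ℝ) (PX : Measure (Euc d)) (η : Euc d → ℝ) (x0 : Euc d),
        0 < C0 ∧ 0 < c0 ∧ 0 < r0 ∧ 0 < μmin ∧ μmin < μmax ∧
        MemPS α C0 β L c0 r0 μmin μmax K PX η ∧
        x0 ∈ interior (msupport PX) ∧ Crosses η (1 / 2) x0 := by
  set c := min (1 / 2) (L / 2) with hc
  have hc0 : 0 < c := by positivity
  have hc1 : c ≤ 1 / 2 := min_le_left _ _
  have hc2 : c ≤ L / 2 := min_le_right _ _
  set p : ℝ → ℝ := fun u => max 0 (min 1 u) with hp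
  have hp0 : ∀ u, 0 ≤ p u := fun u => le_max_left _ _
  have hp1 : ∀ u, p u ≤ 1 := fun u => max_le zero_le_one (min_le_left _ _)
  have hpL : ∀ u v, |p u - p v| ≤ |u - v| := by
    intro u v
    have h0 := abs_max_sub_max_le_max 0 (min 1 u) 0 (min 1 v)
    simp only [sub_self, abs_zero, abs_nonneg, max_eq_right] at h0
    refine h0.trans ?_
    have := abs_min_sub_min_le_max 1 u 1 v
    simpa using this
  have hpn : ∀ u, u ≤ 0 → p u = 0 := fun u hu => max_eq_left ((min_le_right _ _).trans hu)
  have hpp : ∀ u, 0 ≤ u → u ≤ 1 → p u = u := fun u hu hu1 => by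
    simp [hp, hu, hu1]
  set G : ℝ → ℝ := fun u => 1 / 2 + c * (p u ^ β - p (-u) ^ β) with hGdef
  have hGH : ∀ u v, |G u - G v| ≤ L * |u - v| ^ β := by
    intro u v
    have e1 : |p u ^ β - p v ^ β| ≤ |u - v| ^ β :=
      (rpow_holder β hβ hb _ _ (hp0 u) (hp0 v)).trans
        (Real.rpow_le_rpow (abs_nonneg _) (hpL u v) hβ.le)
    have e2 : |p (-u) ^ β - p (-v) ^ β| ≤ |u - v| ^ β := by
      refine (rpow_holder β hβ hb _ _ (hp0 _) (hp0 _)).trans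
        (Real.rpow_le_rpow (abs_nonneg _) ((hpL _ _).trans (le_of_eq ?_)) hβ.le)
      rw [← abs_neg (u - v)]; congr 1; ring
    have e3 : G u - G v = c * ((p u ^ β - p v ^ β) - (p (-u) ^ β - p (-v) ^ β)) := by
      simp only [hGdef]; ring
    rw [e3, abs_mul, abs_of_pos hc0]
    have := norm_sub_le (p u ^ β - p v ^ β) (p (-u) ^ β - p (-v) ^ β)
    have h0 : 0 ≤ |u - v| ^ β := by positivity
    simp only [Real.norm_eq_abs] at this
    calc _ ≤ c * (2 * |u - v| ^ β) := by gcongr; linarith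
      _ ≤ _ := by nlinarith
  have hpow : ∀ u, 0 ≤ p u ^ β ∧ p u ^ β ≤ 1 := fun u =>
    ⟨Real.rpow_nonneg (hp0 u) _, Real.rpow_le_one (hp0 u) (hp1 u) hβ.le⟩
  have hGpos : ∀ u, 0 ≤ u → u ≤ 1 → G u = 1 / 2 + c * u ^ β := by
    intro u h0 h1
    simp only [hGdef, hpp u h0 h1, hpn (-u) (by linarith), Real.zero_rpow hβ.ne', sub_zero]
  have hGneg : ∀ u, 0 ≤ u → u ≤ 1 → G (-u) = 1 / 2 - c * u ^ β := by
    intro u h0 h1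
    simp only [hGdef, neg_neg, hpp u h0 h1, hpn (-u) (by linarith), Real.zero_rpow hβ.ne']
    ring
  have hGc : Continuous G := by
    have hpc : Continuous p := by fun_prop
    have : Continuous fun u : ℝ => u ^ β := Real.continuous_rpow_const hβ.le
    exact continuous_const.add (continuous_const.mul ((this.comp hpc).sub
      (this.comp (hpc.comp continuous_neg))))
  have hN : ⌈β⌉₊ = 1 := by
    apply le_antisymm
    · exact Nat.ceil_le.2 (by simpa using hb)
    · exact Nat.one_le_iff_ne_zero.2 (Nat.ceil_pos.2 hβ).ne'
  refine part2_core α β L hα hβ hab K a R hR hRK (fun x => G (x i - a i)) ?_ ?_ i c hc0 ?_ ?_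
  · intro x
    simp only [hGdef]
    have h1 := hpow (x i - a i)
    have h2 := hpow (-(x i - a i))
    constructor <;> nlinarith
  · constructor
    · rw [hN]
      have : Continuous fun x : Euc d => G (x i - a i) := by fun_prop
      simpa [contDiff_zero] using this
    · intro x x'
      rw [hN]
      have h1 := hGH (x' i - a i) (x i - a i)
      have h2 := PiLp.norm_apply_le (x' - x) i
      simp only [PiLp.sub_apply, Real.norm_eq_abs] at h2
      simp only [taylorPoly, Nat.sub_self, zero_add, Finset.range_one, Finset.sum_singleton,
        Nat.factorial_zero, Nat.cast_one, inv_one, one_mul, iteratedFDeriv_zero_apply]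
      refine h1.trans ?_
      rw [sub_sub_sub_cancel_right]
      gcongr
  · intro x hx
    rw [min_eq_right hb]
    have h1 := PiLp.norm_apply_le (x - a) i
    have h2 := mem_closedBall_iff_norm.1 hx
    simp only [PiLp.sub_apply, Real.norm_eq_abs] at h1
    have h3 : |x i - a i| ≤ 1 := by linarith
    set u := x i - a i with hu
    apply le_of_eq
    rcases le_total 0 u with h | h
    · rw [abs_of_nonneg h] at h3 ⊢
      have : 0 ≤ c * u ^ β := by positivity
      rw [hGpos u h h3, add_sub_cancel_left, abs_of_nonneg this]
    · rw [abs_of_nonpos h] at h3 ⊢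
      have : 0 ≤ c * (-u) ^ β := mul_nonneg hc0.le (Real.rpow_nonneg (by linarith) _)
      have h4 := hGneg (-u) (by linarith) h3
      rw [neg_neg] at h4
      rw [h4, sub_sub_cancel_left, abs_neg, abs_of_nonneg this]
  · apply crosses_aux a i _ G (fun x => rfl)
    · intro u h0 h1
      rw [hGpos u h0.le h1]
      have : 0 < c * u ^ β := by positivity
      linarith
    · intro u h0 h1
      rw [hGneg u h0.le h1]
      have : 0 < c * u ^ β := by positivity
      linarith

lemma sin_taylor (N : ℕ) (x y : ℝ) :
    |Real.sin y - ∑ k ∈ Finset.range (N + 1),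
      (k.factorial : ℝ)⁻¹ * ((y - x) ^ k * iteratedDeriv k Real.sin x)| ≤ |y - x| ^ (N + 1) := by
  rcases eq_or_ne x y with rfl | hxy
  · rw [Finset.sum_range_succ']
    simp
  · obtain ⟨z, -, hz⟩ := taylor_mean_remainder_lagrange_iteratedDeriv (n := N) hxy
      (Real.contDiff_sin.contDiffOn)
    have : taylorWithinEval Real.sin N (uIcc x y) x y = ∑ k ∈ Finset.range (N + 1),
      (k.factorial : ℝ)⁻¹ * ((y - x) ^ k * iteratedDeriv k Real.sin x) := by
      rw [taylor_within_apply]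
      apply Finset.sum_congr rfl
      intro k _
      rw [iteratedDerivWithin_eq_iteratedDeriv (uniqueDiffOn_uIcc hxy)
        Real.contDiff_sin.contDiffAt left_mem_uIcc, smul_eq_mul, mul_assoc]
    rw [← this, hz, abs_div, abs_mul, abs_pow]
    have h1 := Real.abs_iteratedDeriv_sin_le_one (N + 1) z
    have h2 : (1:ℝ) ≤ |((N + 1).factorial : ℝ)| := by
      rw [Nat.abs_cast]; exact_mod_cast Nat.factorial_pos _
    have h3 : 0 ≤ |y - x| ^ (N + 1) := by positivity
    rw [div_le_iff₀ (by linarith)]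
    nlinarith

lemma sin_taylor' (N : ℕ) (hN : 1 ≤ N) (β : ℝ) (h1 : (N : ℝ) < β) (h2 : β ≤ N + 1) (x y : ℝ) :
    |Real.sin y - ∑ k ∈ Finset.range (N + 1),
      (k.factorial : ℝ)⁻¹ * ((y - x) ^ k * iteratedDeriv k Real.sin x)| ≤ 2 * |y - x| ^ β := by
  have hβ : 0 < β := lt_of_le_of_lt (Nat.cast_nonneg _) h1
  have h0 : 0 ≤ |y - x| ^ β := by positivity
  rcases le_or_gt |y - x| 1 with h | h
  · refine (sin_taylor N x y).trans ?_
    have : |y - x| ^ (N + 1) ≤ |y - x| ^ β := by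
      rw [← Real.rpow_natCast]
      rcases eq_or_lt_of_le (abs_nonneg (y - x)) with h' | h'
      · rw [← h', Real.zero_rpow hβ.ne', Real.zero_rpow (by positivity)]
      · exact Real.rpow_le_rpow_of_exponent_ge h' h (by push_cast; exact h2)
    linarith
  · obtain ⟨n, rfl⟩ : ∃ n, N = n + 1 := ⟨N - 1, by omega⟩
    have e1 := sin_taylor n x y
    rw [Finset.sum_range_succ, ← sub_sub]
    have e2 : |((n + 1).factorial : ℝ)⁻¹ * ((y - x) ^ (n + 1) * iteratedDeriv (n + 1) Real.sin x)|
        ≤ |y - x| ^ (n + 1) := by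
      rw [abs_mul, abs_mul, abs_pow]
      have g1 := Real.abs_iteratedDeriv_sin_le_one (n + 1) x
      have g2 : |((n + 1).factorial : ℝ)⁻¹| ≤ 1 := by
        rw [abs_inv, Nat.abs_cast]
        exact inv_le_one_of_one_le₀ (by exact_mod_cast Nat.factorial_pos _)
      calc _ ≤ 1 * (|y - x| ^ (n + 1) * 1) := by gcongr
        _ = _ := by ring
    have e3 : |y - x| ^ (n + 1) ≤ |y - x| ^ β := by
      rw [← Real.rpow_natCast]
      exact Real.rpow_le_rpow_of_exponent_le h.le h1.le
    have := norm_sub_le (Real.sin y - ∑ k ∈ Finset.range (n + 1),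
      (k.factorial : ℝ)⁻¹ * ((y - x) ^ k * iteratedDeriv k Real.sin x))
      (((n + 1).factorial : ℝ)⁻¹ * ((y - x) ^ (n + 1) * iteratedDeriv (n + 1) Real.sin x))
    simp only [Real.norm_eq_abs] at this
    linarith

lemma part2_large {d : ℕ} (α β L : ℝ) (hα : 0 < α) (hβ : 0 < β) (hL : 0 < L) (hb : 1 < β)
    (hab : α * min 1 β ≤ 1) (K : Set (Euc d)) (a : Euc d) (R : ℝ) (hR : 0 < R) (hR1 : R ≤ 1)
    (hRK : closedBall a R ⊆ K) (i : Fin d) :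
    ∃ (C0 c0 r0 μmin μmax : ℝ) (PX : Measure (Euc d)) (η : Euc d → ℝ) (x0 : Euc d),
        0 < C0 ∧ 0 < c0 ∧ 0 < r0 ∧ 0 < μmin ∧ μmin < μmax ∧
        MemPS α C0 β L c0 r0 μmin μmax K PX η ∧
        x0 ∈ interior (msupport PX) ∧ Crosses η (1 / 2) x0 := by
  set c := min (1 / 2) (L / 2) with hc
  have hc0 : 0 < c := by positivity
  have hc1 : c ≤ 1 / 2 := min_le_left _ _
  have hc2 : c ≤ L / 2 := min_le_right _ _
  have hsin : ∀ u : ℝ, |u| ≤ 1 → 1 / 2 * |u| ≤ |Real.sin u| := by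
    intro u hu
    have hpi := Real.pi_gt_three
    have h := Real.mul_abs_le_abs_sin (x := u) (by linarith)
    refine le_trans ?_ h
    have h4 : (1:ℝ) / 2 ≤ 2 / Real.pi := by
      rw [div_le_div_iff₀ two_pos Real.pi_pos]
      linarith [Real.pi_le_four]
    exact mul_le_mul_of_nonneg_right h4 (abs_nonneg _)
  set G : ℝ → ℝ := fun u => 1 / 2 + c * Real.sin u with hG
  have hceil : 2 ≤ ⌈β⌉₊ := Nat.lt_ceil.2 (by simpa using hb)
  refine part2_core α β L hα hβ hab K a R hR hRK (fun x => G (x i - a i)) ?_ ?_ i (c / 2)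
    (by positivity) ?_ ?_
  · intro x
    have h1 := Real.neg_one_le_sin (x i - a i)
    have h2 := Real.sin_le_one (x i - a i)
    simp only [hG]
    constructor <;> nlinarith
  · obtain ⟨N, hN⟩ : ∃ N, ⌈β⌉₊ = N + 1 := ⟨⌈β⌉₊ - 1, by omega⟩
    have hN1 : 1 ≤ N := by omega
    have hNβ : (N : ℝ) < β := Nat.lt_ceil.1 (by omega)
    have hβN : β ≤ N + 1 := by
      have := Nat.le_ceil β
      rw [hN] at this
      exact_mod_cast this
    rw [HolderClass, hN, Nat.add_sub_cancel]
    constructor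
    · simp only [hG]
      fun_prop
    · intro x x'
      set ℓ : Euc d →L[ℝ] ℝ := EuclideanSpace.proj i with hℓ
      set g : ℝ → ℝ := fun u => G (u - a i) with hg
      have hgc : ContDiff ℝ N g := by
        simp only [hg, hG]; fun_prop
      have hd0 : ∀ k, ∀ u, iteratedDeriv k g u =
          (if k = 0 then 1 / 2 else 0) + c * iteratedDeriv k Real.sin (u - a i) := by
        intro k u
        simp only [hg]
        rw [iteratedDeriv_comp_sub_const]
        simp only [hG]
        rw [iteratedDeriv_fun_add (by fun_prop) (by fun_prop), iteratedDeriv_const,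
          iteratedDeriv_const_mul_field]
      have hterm : ∀ k ∈ Finset.range (N + 1),
          (k.factorial : ℝ)⁻¹ * iteratedFDeriv ℝ k (fun x : Euc d => G (x i - a i)) x
            (fun _ => x' - x) =
          (if k = 0 then 1 / 2 else 0) + c * ((k.factorial : ℝ)⁻¹ *
            (((x' i - a i) - (x i - a i)) ^ k * iteratedDeriv k Real.sin (x i - a i))) := by
        intro k hk
        have hkN : k ≤ N := by simpa [Nat.lt_succ_iff] using hk
        have e1 : (fun x : Euc d => G (x i - a i)) = g ∘ ℓ := by
          ext z; simp [hg, hℓ]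
        rw [e1, ContinuousLinearMap.iteratedFDeriv_comp_right ℓ hgc x (by exact_mod_cast hkN),
          ContinuousMultilinearMap.compContinuousLinearMap_apply,
          iteratedFDeriv_apply_eq_iteratedDeriv_mul_prod, hd0]
        have e2 : ℓ (x' - x) = x' i - a i - (x i - a i) := by simp [hℓ]
        have e3 : ℓ x = x i := by simp [hℓ]
        simp only [e2, e3, Finset.prod_const, Finset.card_univ, Fintype.card_fin, smul_eq_mul]
        by_cases hk0 : k = 0
        · subst hk0; simp
        · simp only [hk0, if_false]; ring
      have hT : taylorPoly (fun x : Euc d => G (x i - a i)) N x x' =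
          1 / 2 + c * ∑ k ∈ Finset.range (N + 1), (k.factorial : ℝ)⁻¹ *
            (((x' i - a i) - (x i - a i)) ^ k * iteratedDeriv k Real.sin (x i - a i)) := by
        rw [taylorPoly, Finset.sum_congr rfl hterm, Finset.sum_add_distrib, ← Finset.mul_sum]
        congr 1
        simp
      rw [hT]
      have hmain := sin_taylor' N hN1 β hNβ hβN (x i - a i) (x' i - a i)
      have h2 := PiLp.norm_apply_le (x' - x) i
      simp only [PiLp.sub_apply, Real.norm_eq_abs] at h2
      simp only [hG]
      rw [add_sub_add_left_eq_sub, ← mul_sub, abs_mul, abs_of_pos hc0]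
      calc _ ≤ c * (2 * |x' i - a i - (x i - a i)| ^ β) := by gcongr
        _ ≤ c * (2 * ‖x' - x‖ ^ β) := by rw [sub_sub_sub_cancel_right]; gcongr
        _ ≤ _ := by
          have : 0 ≤ ‖x' - x‖ ^ β := by positivity
          nlinarith
  · intro x hx
    rw [min_eq_left hb.le, Real.rpow_one]
    have h1 := PiLp.norm_apply_le (x - a) i
    have h2 := mem_closedBall_iff_norm.1 hx
    simp only [PiLp.sub_apply, Real.norm_eq_abs] at h1
    have h3 := hsin (x i - a i) (by linarith)
    simp only [hG]
    rw [add_sub_cancel_left, abs_mul, abs_of_pos hc0]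
    nlinarith
  · have hs : ∀ u : ℝ, 0 < u → u ≤ 1 → 0 < c * Real.sin u := fun u h0 h1 =>
      mul_pos hc0 (Real.sin_pos_of_pos_of_lt_pi h0 (by linarith [Real.pi_gt_three]))
    apply crosses_aux a i _ G (fun x => rfl)
    · intro u h0 h1
      have := hs u h0 h1
      simp only [hG]; linarith
    · intro u h0 h1
      have := hs u h0 h1
      simp only [hG, Real.sin_neg]; linarith

/-- Proposition 3.4, last item. If `α(1 ∧ β) > 1`, no distribution of
the class `P_Σ` has a regression function crossing `1/2` in the interior of the support
of `P_X`; conversely, if `α(1 ∧ β) ≤ 1`, for suitable parameters some distribution in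
`P_Σ` has a regression function crossing `1/2` in the interior of the support of `P_X`. -/
theorem stmt6 (d : ℕ) (hd : 1 ≤ d) (α β L : ℝ) (hα : 0 < α) (hβ : 0 < β) (hL : 0 < L)
    (K : Set (Euc d)) (hK : IsCompact K) (hKint : (interior K).Nonempty) :
    ((1 : ℝ) < α * min 1 β →
      ¬ ∃ (C0 c0 r0 μmin μmax : ℝ) (K' : Set (Euc d)) (PX : Measure (Euc d))
          (η : Euc d → ℝ) (x0 : Euc d),
          0 < C0 ∧ 0 < c0 ∧ 0 < r0 ∧ 0 < μmin ∧ μmin ≤ μmax ∧ IsCompact K' ∧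
          MemPS α C0 β L c0 r0 μmin μmax K' PX η ∧
          x0 ∈ interior (msupport PX) ∧ Crosses η (1 / 2) x0) ∧
    (α * min 1 β ≤ 1 →
      ∃ (C0 c0 r0 μmin μmax : ℝ) (PX : Measure (Euc d)) (η : Euc d → ℝ) (x0 : Euc d),
        0 < C0 ∧ 0 < c0 ∧ 0 < r0 ∧ 0 < μmin ∧ μmin < μmax ∧
        MemPS α C0 β L c0 r0 μmin μmax K PX η ∧
        x0 ∈ interior (msupport PX) ∧ Crosses η (1 / 2) x0) := by
  constructor
  · rintro hab ⟨C0, c0, r0, μmin, μmax, K', PX, η, x0, hC0, -, -, hμ, -, -, hP, hx0, hcr⟩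
    exact part1 α β L hβ hL hab C0 c0 r0 μmin μmax K' PX η x0 hC0 hμ hP hx0 hcr
  · intro hab
    obtain ⟨a, ha⟩ := hKint
    obtain ⟨R, hR, hRK⟩ := Metric.nhds_basis_closedBall.mem_iff.1 (mem_interior_iff_mem_nhds.1 ha)
    have hR' : 0 < min R 1 := lt_min hR one_pos
    have hsub : closedBall a (min R 1) ⊆ K :=
      (closedBall_subset_closedBall (min_le_left _ _)).trans hRK
    rcases le_or_gt β 1 with hb | hb
    · exact part2_small α β L hα hβ hL hb hab K a _ hR' (min_le_right _ _) hsub ⟨0, hd⟩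
    · exact part2_large α β L hα hβ hL hb hab K a _ hR' (min_le_right _ _) hsub ⟨0, hd⟩

end
end

section
/- Let d ≥ 1 be an integer and let L, β, α be positive constants such that αβ ≤ d. Then there exist values of the parameters C0, c0, r0 > 0, 0 < μ_min < μ_max < ∞, a compact C ⊂ R^d, and a constant C > 0 such that for every n ≥ 1 and every classifier f̂_n (any measurable function of the sample (X_1,Y_1),…,(X_n,Y_n) with values in decision rules), sup_{P ∈ P_Σ(α, C0, β, L, c0, r0, μ_min, μ_max, C)} { E[R(f̂_n)] − R(f*) } ≥ C n^{−β(1+α)/(2β+d)}. -/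
open MeasureTheory Metric Set
open scoped ENNReal NNReal

noncomputable section

lemma kernel_meas {d : ℕ} (η : Euc d → ℝ) (hη : Measurable η) :
    Measurable (fun x : Euc d => (ENNReal.ofReal (η x) • Measure.dirac (x, true) +
      ENNReal.ofReal (1 - η x) • Measure.dirac (x, false) : Measure (Euc d × Bool))) := by
  apply Measure.measurable_of_measurable_coe
  intro s hs
  simp only [Measure.coe_add, Measure.coe_smul, Pi.add_apply, Pi.smul_apply, smul_eq_mul,
    Measure.dirac_apply' _ hs]
  have h1 : ∀ b : Bool, Measurable (fun x : Euc d => s.indicator (1 : Euc d × Bool → ℝ≥0∞) (x, b)) :=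
    fun b => (measurable_one.indicator hs).comp (by fun_prop)
  exact ((hη.ennreal_ofReal).mul (h1 true)).add
    (((measurable_const.sub hη).ennreal_ofReal).mul (h1 false))

/-- density of one observation. -/
def dens {d : ℕ} (η : Euc d → ℝ) (z : Euc d × Bool) : ℝ := if z.2 then η z.1 else 1 - η z.1

lemma dens_meas {d : ℕ} (η : Euc d → ℝ) (hη : Measurable η) : Measurable (dens η) := by
  unfold dens
  refine Measurable.ite ?_ (by fun_prop) (by fun_prop)
  exact measurable_snd (measurableSet_singleton true)

lemma jointLaw_eq {d : ℕ} (PX : Measure (Euc d)) [SFinite PX] (η : Euc d → ℝ) (hη : Measurable η) :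
    jointLaw PX η = (PX.prod Measure.count).withDensity (fun z => ENNReal.ofReal (dens η z)) := by
  ext s hs
  unfold jointLaw
  rw [Measure.bind_apply hs (kernel_meas η hη).aemeasurable, withDensity_apply _ hs,
    ← lintegral_indicator hs, lintegral_prod _ (by
      exact ((dens_meas η hη).ennreal_ofReal.indicator hs).aemeasurable)]
  congr 1 with x
  rw [lintegral_count, tsum_fintype]
  simp [Measure.dirac_apply' _ hs, Set.indicator, dens]

lemma integral_prod_count {d : ℕ} (PX : Measure (Euc d)) [IsFiniteMeasure PX]
    (g : Euc d × Bool → ℝ) (hg : Integrable g (PX.prod Measure.count)) :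
    ∫ z, g z ∂(PX.prod Measure.count) = ∫ x, (g (x, true) + g (x, false)) ∂PX := by
  rw [integral_prod _ hg]
  congr 1 with x
  rw [integral_countable' (Integrable.of_finite)]
  simp [tsum_fintype, measureReal_def, Measure.count_singleton]

lemma pi_withDensity' {Z : Type*} [MeasurableSpace Z] (Q : Measure Z) [IsFiniteMeasure Q]
    (p : Z → ℝ) (hp : Measurable p) (h0 : ∀ z, 0 ≤ p z) (hi : Integrable p Q) (n : ℕ) :
    Measure.pi (fun _ : Fin n => Q.withDensity fun z => ENNReal.ofReal (p z)) =
      (Measure.pi fun _ : Fin n => Q).withDensity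
        fun ω => ENNReal.ofReal (∏ i, p (ω i)) := by
  haveI : IsFiniteMeasure (Q.withDensity fun z => ENNReal.ofReal (p z)) :=
    isFiniteMeasure_withDensity_ofReal hi.2
  apply Measure.pi_eq
  intro s hs
  rw [withDensity_apply _ (MeasurableSet.univ_pi hs), ← lintegral_indicator (MeasurableSet.univ_pi hs)]
  have e1 : ∀ ω : Fin n → Z, (univ.pi s).indicator (fun ω => ENNReal.ofReal (∏ i, p (ω i))) ω =
      ENNReal.ofReal (∏ i, (s i).indicator p (ω i)) := by
    intro ω
    by_cases h : ω ∈ univ.pi s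
    · rw [indicator_of_mem h]
      congr 1
      refine Finset.prod_congr rfl fun i _ => ?_
      rw [indicator_of_mem (h i (mem_univ i))]
    · rw [indicator_of_notMem h]
      simp only [mem_pi, mem_univ, true_imp_iff, not_forall] at h
      obtain ⟨i, hi⟩ := h
      rw [Finset.prod_eq_zero (Finset.mem_univ i) (indicator_of_notMem hi p)]
      simp
  simp_rw [e1]
  rw [← ofReal_integral_eq_lintegral_ofReal]
  · rw [integral_fintype_prod_eq_prod (fun i => (s i).indicator p),
      ENNReal.ofReal_prod_of_nonneg]
    · refine Finset.prod_congr rfl fun i _ => ?_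
      rw [withDensity_apply _ (hs i), integral_indicator (hs i), ofReal_integral_eq_lintegral_ofReal]
      · exact hi.integrableOn
      · exact Filter.Eventually.of_forall h0
    · intro i _
      exact integral_nonneg fun z => indicator_nonneg (fun z _ => h0 z) z
  · exact Integrable.fintype_prod (f := fun i => (s i).indicator p) fun i => hi.indicator (hs i)
  · exact Filter.Eventually.of_forall fun ω =>
      Finset.prod_nonneg fun i _ => indicator_nonneg (fun z _ => h0 z) _

lemma testing {Z : Type*} [MeasurableSpace Z] (Q : Measure Z) [IsFiniteMeasure Q]
    (p p' r : Z → ℝ) (hp : Measurable p) (hp' : Measurable p')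
    (h0 : ∀ z, 0 ≤ p z) (h0' : ∀ z, 0 ≤ p' z) (hr0 : ∀ z, 0 ≤ r z)
    (hi : Integrable p Q) (hi' : Integrable p' Q) (hri : Integrable r Q)
    (h1 : ∫ z, p z ∂Q = 1) (h1' : ∫ z, p' z ∂Q = 1)
    (hr : ∀ z, r z ^ 2 ≤ p z * p' z) (n : ℕ) (A : Set (Fin n → Z)) (hA : MeasurableSet A) :
    1 / 2 * ((∫ z, r z ∂Q) ^ n - 1 / 4) ≤
      (Measure.pi (fun _ : Fin n => Q.withDensity fun z => ENNReal.ofReal (p z))).real A +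
      (Measure.pi (fun _ : Fin n => Q.withDensity fun z => ENNReal.ofReal (p' z))).real Aᶜ := by
  have key : ∀ (f : Z → ℝ), Measurable f → (∀ z, 0 ≤ f z) → Integrable f Q →
      ∀ B : Set (Fin n → Z), MeasurableSet B →
      (Measure.pi (fun _ : Fin n => Q.withDensity fun z => ENNReal.ofReal (f z))).real B =
        ∫ ω in B, ∏ i, f (ω i) ∂(Measure.pi fun _ : Fin n => Q) := by
    intro f hf hf0 hfi B hB
    rw [pi_withDensity' Q f hf hf0 hfi, measureReal_def, withDensity_apply _ hB,
      ← ofReal_integral_eq_lintegral_ofReal, ENNReal.toReal_ofReal]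
    · exact integral_nonneg fun ω => Finset.prod_nonneg fun i _ => hf0 _
    · exact (Integrable.fintype_prod (f := fun _ => f) fun i => hfi).integrableOn
    · exact Filter.Eventually.of_forall fun ω => Finset.prod_nonneg fun i _ => hf0 _
  rw [key p hp h0 hi A hA, key p' hp' h0' hi' _ hA.compl]
  set QQ := Measure.pi fun _ : Fin n => Q with hQQ
  have I : ∀ (f : Z → ℝ), Integrable f Q → Integrable (fun ω : Fin n → Z => ∏ i, f (ω i)) QQ :=
    fun f hf => Integrable.fintype_prod (f := fun _ => f) fun i => hf
  have T : ∀ (f : Z → ℝ), ∫ ω, ∏ i, f (ω i) ∂QQ = (∫ z, f z ∂Q) ^ n := by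
    intro f
    rw [hQQ, integral_fintype_prod_eq_prod (fun _ => f)]
    simp
  have S : ∀ (f : Z → ℝ), Integrable f Q → ∫ ω in A, ∏ i, f (ω i) ∂QQ +
      ∫ ω in Aᶜ, ∏ i, f (ω i) ∂QQ = (∫ z, f z ∂Q) ^ n := fun f hf => by
    rw [integral_add_compl hA (I f hf), T]
  have sp := S p hi
  have sp' := S p' hi'
  have sr := S r hri
  rw [h1, one_pow] at sp
  rw [h1', one_pow] at sp'
  have nn : ∀ (f : Z → ℝ), (∀ z, 0 ≤ f z) → ∀ ω : Fin n → Z, 0 ≤ ∏ i, f (ω i) :=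
    fun f hf ω => Finset.prod_nonneg fun i _ => hf _
  have sq : ∀ ω : Fin n → Z, (∏ i, r (ω i)) ^ 2 ≤ (∏ i, p (ω i)) * ∏ i, p' (ω i) := by
    intro ω
    rw [← Finset.prod_pow, ← Finset.prod_mul_distrib]
    exact Finset.prod_le_prod (fun i _ => sq_nonneg _) fun i _ => hr _
  have amgm : ∀ a b c : ℝ, 0 ≤ a → 0 ≤ b → 0 ≤ c → c ^ 2 ≤ a * b → c ≤ 2 * a + b / 8 := by
    intro a b c ha hb hc h
    apply le_of_sq_le_sq _ (by positivity)
    nlinarith [sq_nonneg (2 * a - b / 8)]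
  have b1 : ∫ ω in A, ∏ i, r (ω i) ∂QQ ≤
      2 * ∫ ω in A, ∏ i, p (ω i) ∂QQ + (∫ ω in A, ∏ i, p' (ω i) ∂QQ) / 8 := by
    rw [← integral_const_mul, ← integral_div, ← integral_add
      ((I p hi).integrableOn.const_mul 2) ((I p' hi').integrableOn.div_const 8)]
    refine integral_mono (I r hri).integrableOn
      (((I p hi).integrableOn.const_mul 2).add ((I p' hi').integrableOn.div_const 8)) fun ω => ?_
    exact amgm _ _ _ (nn p h0 ω) (nn p' h0' ω) (nn r hr0 ω) (sq ω)
  have b2 : ∫ ω in Aᶜ, ∏ i, r (ω i) ∂QQ ≤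
      2 * ∫ ω in Aᶜ, ∏ i, p' (ω i) ∂QQ + (∫ ω in Aᶜ, ∏ i, p (ω i) ∂QQ) / 8 := by
    rw [← integral_const_mul, ← integral_div, ← integral_add
      ((I p' hi').integrableOn.const_mul 2) ((I p hi).integrableOn.div_const 8)]
    refine integral_mono (I r hri).integrableOn
      (((I p' hi').integrableOn.const_mul 2).add ((I p hi).integrableOn.div_const 8)) fun ω => ?_
    exact amgm _ _ _ (nn p' h0' ω) (nn p h0 ω) (nn r hr0 ω) (by rw [mul_comm]; exact sq ω)
  have q1 : 0 ≤ ∫ ω in A, ∏ i, p (ω i) ∂QQ := integral_nonneg fun ω => nn p h0 ω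
  have q2 : 0 ≤ ∫ ω in Aᶜ, ∏ i, p' (ω i) ∂QQ := integral_nonneg fun ω => nn p' h0' ω
  linarith

lemma dens_nonneg {d : ℕ} {η : Euc d → ℝ} (h : ∀ x, η x ∈ Icc (0 : ℝ) 1) (z) : 0 ≤ dens η z := by
  unfold dens; split_ifs
  · exact (h _).1
  · linarith [(h z.1).2]

lemma dens_le {d : ℕ} {η : Euc d → ℝ} (h : ∀ x, η x ∈ Icc (0 : ℝ) 1) (z) : dens η z ≤ 1 := by
  unfold dens; split_ifs
  · exact (h _).2
  · linarith [(h z.1).1]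

lemma dens_int {d : ℕ} (PX : Measure (Euc d)) [IsProbabilityMeasure PX] {η : Euc d → ℝ}
    (hm : Measurable η) (h : ∀ x, η x ∈ Icc (0 : ℝ) 1) :
    Integrable (dens η) (PX.prod Measure.count) := by
  refine Integrable.of_bound (dens_meas η hm).aestronglyMeasurable 1 ?_
  refine Filter.Eventually.of_forall fun z => ?_
  rw [Real.norm_eq_abs, abs_of_nonneg (dens_nonneg h z)]
  exact dens_le h z

lemma dens_one {d : ℕ} (PX : Measure (Euc d)) [IsProbabilityMeasure PX] {η : Euc d → ℝ}
    (hm : Measurable η) (h : ∀ x, η x ∈ Icc (0 : ℝ) 1) :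
    ∫ z, dens η z ∂(PX.prod Measure.count) = 1 := by
  rw [integral_prod_count PX _ (dens_int PX hm h)]
  simp [dens]

lemma jointLaw_prob {d : ℕ} (PX : Measure (Euc d)) [IsProbabilityMeasure PX] {η : Euc d → ℝ}
    (hm : Measurable η) (h : ∀ x, η x ∈ Icc (0 : ℝ) 1) :
    IsProbabilityMeasure (jointLaw PX η) := by
  rw [jointLaw_eq PX η hm]
  constructor
  rw [withDensity_apply _ MeasurableSet.univ, Measure.restrict_univ,
    ← ofReal_integral_eq_lintegral_ofReal (dens_int PX hm h)
      (Filter.Eventually.of_forall (dens_nonneg h)), dens_one PX hm h]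
  simp

lemma sampleLaw_prob {d : ℕ} (PX : Measure (Euc d)) [IsProbabilityMeasure PX] {η : Euc d → ℝ}
    (hm : Measurable η) (h : ∀ x, η x ∈ Icc (0 : ℝ) 1) (n : ℕ) :
    IsProbabilityMeasure (sampleLaw PX η n) := by
  have := jointLaw_prob PX hm h
  unfold sampleLaw
  infer_instance

lemma two_point {d : ℕ} (PX : Measure (Euc d)) [IsProbabilityMeasure PX] {η η' : Euc d → ℝ}
    (hm : Measurable η) (hm' : Measurable η') (a w : ℝ) (ha : 0 < a) (ha4 : a ≤ 1 / 4)
    (h : ∀ x, |η x - 1 / 2| ≤ a) (hsw : ∀ x, η' x = η x ∨ η' x = 1 - η x)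
    (hw : PX.real {x | η x ≠ η' x} ≤ w) (n : ℕ) (hn : a ^ 2 * w * n ≤ 1 / 16)
    (A : Set (Sample d n)) (hA : MeasurableSet A) :
    1 / 4 ≤ (sampleLaw PX η n).real A + (sampleLaw PX η' n).real Aᶜ := by
  have h01 : ∀ x, η x ∈ Icc (0 : ℝ) 1 := fun x => by
    have := abs_le.1 (h x)
    constructor <;> linarith
  have h01' : ∀ x, η' x ∈ Icc (0 : ℝ) 1 := fun x => by
    obtain h | h := hsw x <;> rw [h]
    · exact h01 x
    · constructor <;> linarith [(h01 x).1, (h01 x).2]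
  have hD : MeasurableSet {x | η x ≠ η' x} := (measurableSet_eq_fun hm hm').compl
  classical
  let r : Euc d × Bool → ℝ := fun z =>
    if z.1 ∈ {x | η x ≠ η' x} then 1 / 2 * (1 - 4 * a ^ 2) else dens η z
  have a2 : a ^ 2 ≤ 1 / 16 := by nlinarith
  have hr0 : ∀ z, 0 ≤ r z := by
    intro z
    simp only [r]
    split_ifs
    · linarith
    · exact dens_nonneg h01 z
  have hrm : Measurable r := by
    refine Measurable.ite (measurable_fst hD) measurable_const (dens_meas η hm)
  have hri : Integrable r (PX.prod Measure.count) := by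
    refine Integrable.of_bound hrm.aestronglyMeasurable 1 ?_
    refine Filter.Eventually.of_forall fun z => ?_
    rw [Real.norm_eq_abs, abs_of_nonneg (hr0 z)]
    simp only [r]
    split_ifs
    · nlinarith [sq_nonneg a]
    · exact dens_le h01 z
  have hr : ∀ z, r z ^ 2 ≤ dens η z * dens η' z := by
    intro z
    simp only [r]
    by_cases hz : η z.1 ≠ η' z.1
    · rw [if_pos (by exact hz)]
      have h2 : η' z.1 = 1 - η z.1 := by
        obtain h | h := hsw z.1
        · exact absurd h.symm hz
        · exact h
      have h3 : (η z.1 - 1 / 2) ^ 2 ≤ a ^ 2 := by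
        rw [← sq_abs]
        have := h z.1
        gcongr
      have h4 : dens η z * dens η' z = 1 / 4 - (η z.1 - 1 / 2) ^ 2 := by
        unfold dens; rw [h2]; split_ifs <;> ring
      rw [h4]
      nlinarith [sq_nonneg a]
    · rw [if_neg (by exact hz)]
      push Not at hz
      have : dens η' z = dens η z := by unfold dens; rw [hz]
      rw [this, sq]
  have key := testing (PX.prod Measure.count) (dens η) (dens η') r (dens_meas η hm)
    (dens_meas η' hm') (dens_nonneg h01) (dens_nonneg h01') hr0 (dens_int PX hm h01)
    (dens_int PX hm' h01') hri (dens_one PX hm h01) (dens_one PX hm' h01') hr n A hA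
  rw [← jointLaw_eq PX η hm, ← jointLaw_eq PX η' hm'] at key
  have hρ : ∫ z, r z ∂(PX.prod Measure.count) = 1 - 4 * a ^ 2 * PX.real {x | η x ≠ η' x} := by
    rw [integral_prod_count PX r hri]
    have : ∀ x, r (x, true) + r (x, false) =
        1 - {x | η x ≠ η' x}.indicator (fun _ => 4 * a ^ 2) x := by
      intro x
      by_cases hx : x ∈ {x | η x ≠ η' x}
      · simp only [r, if_pos hx, indicator_of_mem hx]; ring
      · simp only [r, if_neg hx, indicator_of_notMem hx, dens]; simp
    simp_rw [this]
    rw [integral_sub (integrable_const _) ((integrable_const _).indicator hD),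
      integral_indicator hD]
    simp
    ring
  have hb : 3 / 4 ≤ (∫ z, r z ∂(PX.prod Measure.count)) ^ n := by
    rw [hρ]
    have hp1 : PX.real {x | η x ≠ η' x} ≤ 1 := measureReal_le_one
    have hp0 : 0 ≤ PX.real {x | η x ≠ η' x} := measureReal_nonneg
    have := one_add_mul_le_pow (a := - (4 * a ^ 2 * PX.real {x | η x ≠ η' x}))
      (by nlinarith [sq_nonneg a]) n
    have h5 : a ^ 2 * PX.real {x | η x ≠ η' x} * n ≤ a ^ 2 * w * n := by gcongr
    rw [sub_eq_add_neg]
    nlinarith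
  unfold sampleLaw
  linarith

/-- pointwise excess. -/
def exD {d n : ℕ} (η : Euc d → ℝ) (fhat : Sample d n → Euc d → Bool) (ω : Sample d n) (x : Euc d) :
    ℝ := if fhat ω x = bayes η x then 0 else |2 * η x - 1|

lemma bayes_meas {d : ℕ} (η : Euc d → ℝ) (hη : Measurable η) : Measurable (bayes η) := by
  unfold bayes
  refine measurable_to_bool ?_
  have : (fun x => decide ((1 : ℝ) / 2 ≤ η x)) ⁻¹' {true} = {x | 1 / 2 ≤ η x} := by ext; simp
  rw [this]
  exact measurableSet_le measurable_const hη

lemma exD_meas {d n : ℕ} (η : Euc d → ℝ) (hη : Measurable η) (fhat : Sample d n → Euc d → Bool)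
    (hf : Measurable (Function.uncurry fhat)) :
    Measurable (fun z : Sample d n × Euc d => exD η fhat z.1 z.2) := by
  unfold exD
  refine Measurable.ite ?_ measurable_const ?_
  · exact measurableSet_eq_fun hf ((bayes_meas η hη).comp measurable_snd)
  · exact (((hη.comp measurable_snd).const_mul 2).sub_const 1).abs

lemma exD_bound {d n : ℕ} (η : Euc d → ℝ) (h : ∀ x, η x ∈ Icc (0 : ℝ) 1)
    (fhat : Sample d n → Euc d → Bool) (ω x) : 0 ≤ exD η fhat ω x ∧ exD η fhat ω x ≤ 1 := by
  unfold exD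
  split_ifs
  · simp
  · refine ⟨abs_nonneg _, abs_le.2 ⟨?_, ?_⟩⟩ <;> linarith [(h x).1, (h x).2]

lemma exD_int {d n : ℕ} (PX : Measure (Euc d)) [IsProbabilityMeasure PX] {η : Euc d → ℝ}
    (hm : Measurable η) (h : ∀ x, η x ∈ Icc (0 : ℝ) 1)
    (fhat : Sample d n → Euc d → Bool)
    (hf : Measurable (Function.uncurry fhat)) :
    Integrable (fun z : Sample d n × Euc d => exD η fhat z.1 z.2) ((sampleLaw PX η n).prod PX) := by
  have := sampleLaw_prob PX hm h n
  refine Integrable.of_bound (exD_meas η hm fhat hf).aestronglyMeasurable 1 ?_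
  refine Filter.Eventually.of_forall fun z => ?_
  rw [Real.norm_eq_abs, abs_of_nonneg (exD_bound η h fhat _ _).1]
  exact (exD_bound η h fhat _ _).2

lemma excess_eq {d n : ℕ} (PX : Measure (Euc d)) [IsProbabilityMeasure PX] {η : Euc d → ℝ}
    (hm : Measurable η) (h : ∀ x, η x ∈ Icc (0 : ℝ) 1)
    (fhat : Sample d n → Euc d → Bool)
    (hf : Measurable (Function.uncurry fhat)) :
    expExcessRule PX η fhat = ∫ x, ∫ ω, exD η fhat ω x ∂(sampleLaw PX η n) ∂PX := by
  have := sampleLaw_prob PX hm h n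
  have hI := exD_int PX hm h fhat hf
  have hrI : ∀ f : Euc d → Bool, Measurable f →
      Integrable (fun x => if f x then 1 - η x else η x) PX := by
    intro f hf
    refine Integrable.of_bound (C := 1) (Measurable.aestronglyMeasurable ?_) ?_
    · exact Measurable.ite (hf (measurableSet_singleton true)) (by fun_prop) hm
    · refine Filter.Eventually.of_forall fun x => ?_
      rw [Real.norm_eq_abs, abs_le]
      split_ifs <;> constructor <;> linarith [(h x).1, (h x).2]
  have h1 : ∀ ω, risk PX η (fhat ω) = risk PX η (bayes η) + ∫ x, exD η fhat ω x ∂PX := by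
    intro ω
    have hfω : Measurable (fhat ω) := hf.comp (measurable_const.prodMk measurable_id)
    have hIω : Integrable (fun x => exD η fhat ω x) PX := by
      refine Integrable.of_bound (C := 1) (Measurable.aestronglyMeasurable ?_) ?_
      · exact (exD_meas η hm fhat hf).comp (measurable_const.prodMk measurable_id)
      · refine Filter.Eventually.of_forall fun z => ?_
        rw [Real.norm_eq_abs, abs_of_nonneg (exD_bound η h fhat _ _).1]
        exact (exD_bound η h fhat _ _).2
    unfold risk
    rw [← integral_add (hrI _ (bayes_meas η hm)) hIω]
    congr 1 with x
    unfold exD bayes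
    by_cases hb : (1 : ℝ) / 2 ≤ η x
    · have : |2 * η x - 1| = 2 * η x - 1 := abs_of_nonneg (by linarith)
      have hd : decide ((1 : ℝ) / 2 ≤ η x) = true := decide_eq_true hb
      rw [this, hd]
      cases fhat ω x <;> simp
      ring
    · have : |2 * η x - 1| = - (2 * η x - 1) := abs_of_nonpos (by linarith)
      have hd : decide ((1 : ℝ) / 2 ≤ η x) = false := decide_eq_false hb
      rw [this, hd]
      cases fhat ω x <;> simp
      ring
  unfold expExcessRule
  simp_rw [h1]
  rw [integral_add (integrable_const _) hI.integral_prod_left]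
  simp only [integral_const, probReal_univ, one_smul, add_sub_cancel_left]
  rw [integral_integral_swap hI]

/-- flip coordinate `k`. -/
def flp {ι : Type*} [DecidableEq ι] (k : ι) (σ : ι → Bool) : ι → Bool :=
  Function.update σ k (!σ k)

lemma flp_invol {ι : Type*} [DecidableEq ι] (k : ι) : Function.Involutive (flp k : (ι → Bool) → _) := by
  intro σ
  unfold flp
  simp

lemma assouad {d n : ℕ} (PX : Measure (Euc d)) [IsProbabilityMeasure PX]
    {ι : Type*} [Fintype ι] [DecidableEq ι] (S : Finset ι) (B : ι → Set (Euc d))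
    (hB : ∀ k, MeasurableSet (B k)) (hBd : Pairwise (Function.onFun Disjoint B))
    (η : (ι → Bool) → Euc d → ℝ) (hm : ∀ σ, Measurable (η σ))
    (a w : ℝ) (ha : 0 < a) (ha4 : a ≤ 1 / 4) (h : ∀ σ x, |η σ x - 1 / 2| ≤ a)
    (hin : ∀ σ, ∀ k ∈ S, ∀ x ∈ B k, η σ x = 1 / 2 + if σ k then a else -a)
    (hsw : ∀ σ k x, η (flp k σ) x = η σ x ∨ η (flp k σ) x = 1 - η σ x)
    (hw : ∀ σ k, PX.real {x | η σ x ≠ η (flp k σ) x} ≤ w)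
    (hBw : ∀ k, PX.real (B k) = w) (hn : a ^ 2 * w * n ≤ 1 / 16)
    (fhat : Sample d n → Euc d → Bool) (hf : Measurable (Function.uncurry fhat)) :
    ∃ σ, S.card * w * a / 4 ≤ expExcessRule PX (η σ) fhat := by
  have h01 : ∀ σ x, η σ x ∈ Icc (0 : ℝ) 1 := fun σ x => by
    have := abs_le.1 (h σ x)
    constructor <;> linarith
  have hP := fun σ => sampleLaw_prob PX (hm σ) (h01 σ) n
  set N : ℝ := ((Fintype.card (ι → Bool) : ℕ) : ℝ) with hN
  let G : (ι → Bool) → Euc d → ℝ := fun σ x => ∫ ω, exD (η σ) fhat ω x ∂(sampleLaw PX (η σ) n)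
  have hG0 : ∀ σ x, 0 ≤ G σ x := fun σ x =>
    integral_nonneg fun ω => (exD_bound (η σ) (h01 σ) fhat ω x).1
  have hGI : ∀ σ, Integrable (G σ) PX := fun σ =>
    (exD_int PX (hm σ) (h01 σ) fhat hf).integral_prod_right
  have hGB : ∀ σ, ∀ k ∈ S, ∀ x ∈ B k,
      G σ x = 2 * a * (sampleLaw PX (η σ) n).real {ω | fhat ω x ≠ σ k} := by
    intro σ k hk x hx
    have hms : MeasurableSet {ω | fhat ω x ≠ σ k} := by
      have : Measurable (fun ω => fhat ω x) := hf.comp (measurable_id.prodMk measurable_const)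
      exact (measurableSet_eq_fun this measurable_const).compl
    have hv := hin σ k hk x hx
    have hb : bayes (η σ) x = σ k := by
      unfold bayes
      rw [hv]
      cases hs : σ k
      · simp; linarith
      · simp; linarith
    have hab : |2 * η σ x - 1| = 2 * a := by
      rw [hv]
      cases hs : σ k
      · simp only [Bool.false_eq_true, if_false]
        rw [abs_of_nonpos (by linarith)]; ring
      · simp only [if_true]
        rw [abs_of_nonneg (by linarith)]; ring
    have : ∀ ω, exD (η σ) fhat ω x = {ω | fhat ω x ≠ σ k}.indicator (fun _ => 2 * a) ω := by
      intro ω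
      unfold exD
      rw [hb, hab]
      by_cases hc : fhat ω x = σ k <;> simp [hc]
    simp only [G, this]
    rw [integral_indicator hms]
    simp [mul_comm]
  have hsum : ∀ k ∈ S, ∀ x ∈ B k, a * N / 4 ≤ ∑ σ, G σ x := by
    intro k hk x hx
    have e : ∑ σ, G (flp k σ) x = ∑ σ, G σ x :=
      Equiv.sum_comp (flp_invol k).toPerm (fun σ => G σ x)
    have h2 : ∀ σ, a / 2 ≤ G σ x + G (flp k σ) x := by
      intro σ
      rw [hGB σ k hk x hx, hGB (flp k σ) k hk x hx]
      have hms : MeasurableSet {ω | fhat ω x ≠ σ k} := by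
        have : Measurable (fun ω => fhat ω x) := hf.comp (measurable_id.prodMk measurable_const)
        exact (measurableSet_eq_fun this measurable_const).compl
      have := two_point PX (hm σ) (hm (flp k σ)) a w ha ha4 (h σ) (hsw σ k) (hw σ k) n hn _ hms
      have hc : {ω | fhat ω x ≠ (flp k σ) k} = {ω | fhat ω x ≠ σ k}ᶜ := by
        ext ω
        simp only [flp, Function.update_self, mem_setOf_eq, mem_compl_iff]
        cases fhat ω x <;> cases σ k <;> simp
      rw [hc]
      nlinarith
    have h3 : ∑ σ : ι → Bool, a / 2 ≤ ∑ σ, (G σ x + G (flp k σ) x) := Finset.sum_le_sum fun σ _ => h2 σ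
    rw [Finset.sum_add_distrib, e] at h3
    simp only [Finset.sum_const, Finset.card_univ, nsmul_eq_mul, ← hN] at h3
    linarith
  have hU : MeasurableSet (⋃ k ∈ S, B k) := Finset.measurableSet_biUnion S fun k _ => hB k
  have hUm : PX.real (⋃ k ∈ S, B k) = S.card * w := by
    rw [measureReal_biUnion_finset (fun i _ j _ hij => hBd hij) (fun k _ => hB k)]
    simp [hBw]
  have main : N * (S.card * w * a / 4) ≤ ∑ σ, expExcessRule PX (η σ) fhat := by
    have e1 : ∑ σ, expExcessRule PX (η σ) fhat = ∫ x, ∑ σ, G σ x ∂PX := by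
      rw [integral_finset_sum _ fun σ _ => hGI σ]
      exact Finset.sum_congr rfl fun σ _ => excess_eq PX (hm σ) (h01 σ) fhat hf
    rw [e1]
    have e2 : N * (S.card * w * a / 4) =
        ∫ x, (⋃ k ∈ S, B k).indicator (fun _ => a * N / 4) x ∂PX := by
      rw [integral_indicator hU]
      simp [hUm]; ring
    rw [e2]
    refine integral_mono ((integrable_const _).indicator hU)
      (integrable_finset_sum _ fun σ _ => hGI σ) fun x => ?_
    by_cases hx : x ∈ ⋃ k ∈ S, B k
    · simp only [indicator_of_mem hx]
      simp only [mem_iUnion, exists_prop] at hx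
      obtain ⟨k, hk, hx⟩ := hx
      exact hsum k hk x hx
    · simp only [indicator_of_notMem hx]
      exact Finset.sum_nonneg fun σ _ => hG0 σ x
  by_contra! hcon
  have : ∑ σ, expExcessRule PX (η σ) fhat < ∑ σ : ι → Bool, (S.card * w * a / 4) :=
    Finset.sum_lt_sum_of_nonempty Finset.univ_nonempty fun σ _ => hcon σ
  simp only [Finset.sum_const, Finset.card_univ, nsmul_eq_mul, ← hN] at this
  linarith

lemma taylor_bound {d : ℕ} (β : ℝ) (hβ : 0 < β) (v : Euc d → ℝ) (M : ℝ)
    (hv : ∀ m : ℕ, ContDiff ℝ m v)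
    (hM : ∀ j ≤ (⌈β⌉₊ - 1) + 1, ∀ y, ‖iteratedFDeriv ℝ j v y‖ ≤ M) (y y' : Euc d) :
    |v y' - taylorPoly v (⌈β⌉₊ - 1) y y'| ≤ (((⌈β⌉₊ - 1 : ℕ) : ℝ) + 2) * M * ‖y' - y‖ ^ β := by
  have hc1 : 1 ≤ ⌈β⌉₊ := Nat.one_le_iff_ne_zero.2 (Nat.ceil_pos.2 hβ).ne'
  have hc2 : β ≤ ⌈β⌉₊ := Nat.le_ceil β
  have hc3 : (⌈β⌉₊ : ℝ) < β + 1 := Nat.ceil_lt_add_one hβ.le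
  obtain ⟨N, hN⟩ : ∃ N, ⌈β⌉₊ = N + 1 := ⟨⌈β⌉₊ - 1, by omega⟩
  rw [hN] at hM hc2 hc3 ⊢
  simp only [Nat.add_sub_cancel] at hM ⊢
  push_cast at hc2 hc3
  have hM0 : 0 ≤ M := le_trans (norm_nonneg _) (hM 0 (by omega) y)
  have hterm : ∀ j ≤ N + 1, ∀ z, |iteratedFDeriv ℝ j v z (fun _ => y' - y)| ≤ M * ‖y' - y‖ ^ j := by
    intro j hj z
    have := (iteratedFDeriv ℝ j v z).le_opNorm (fun _ => y' - y)
    simp only [Finset.prod_const, Finset.card_univ, Fintype.card_fin, Real.norm_eq_abs] at this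
    exact this.trans (by gcongr; exact hM j hj z)
  have hfac : ∀ k : ℕ, |((k.factorial : ℝ))⁻¹| ≤ 1 := by
    intro k
    rw [abs_of_nonneg (by positivity)]
    exact inv_le_one_of_one_le₀ (by exact_mod_cast Nat.succ_le_of_lt (Nat.factorial_pos k))
  rcases le_total ‖y' - y‖ 1 with h1 | h1
  · have tay := map_add_eq_sum_add_integral_iteratedFDeriv (f := v) (x := y) (y := y' - y) (n := N)
      (fun t _ => (by exact_mod_cast (hv (N + 1)).contDiffAt))
    have e : v y' - taylorPoly v N y y' = (N.factorial : ℝ)⁻¹ • ∫ t in (0:ℝ)..1, (1 - t)^N •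
        iteratedFDeriv ℝ (N + 1) v (y + t • (y' - y)) (fun _ ↦ y' - y) := by
      rw [add_sub_cancel] at tay
      rw [tay]
      unfold taylorPoly
      simp only [smul_eq_mul]
      ring
    have hIntB : ‖∫ t in (0:ℝ)..1, (1 - t)^N •
        iteratedFDeriv ℝ (N + 1) v (y + t • (y' - y)) (fun _ ↦ y' - y)‖ ≤
        (M * ‖y' - y‖ ^ (N + 1)) * |(1:ℝ) - 0| := by
      apply intervalIntegral.norm_integral_le_of_norm_le_const
      intro t ht
      rw [uIoc_of_le zero_le_one] at ht
      rw [norm_smul, norm_pow, Real.norm_eq_abs, Real.norm_eq_abs]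
      have : |1 - t| ^ N ≤ 1 := pow_le_one₀ (abs_nonneg _)
        (abs_le.2 ⟨by linarith [ht.2], by linarith [ht.1]⟩)
      calc _ ≤ 1 * (M * ‖y' - y‖ ^ (N + 1)) := by
            gcongr
            exact hterm _ le_rfl _
        _ = _ := one_mul _
    rw [e, smul_eq_mul, abs_mul]
    rw [Real.norm_eq_abs] at hIntB
    have hp : ‖y' - y‖ ^ (N + 1) ≤ ‖y' - y‖ ^ β := by
      rw [← Real.rpow_natCast]
      exact Real.rpow_le_rpow_of_exponent_ge' (norm_nonneg _) h1 hβ.le (by push_cast; exact hc2)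
    have hb0 : 0 ≤ M * ‖y' - y‖ ^ β := by positivity
    calc _ ≤ 1 * ((M * ‖y' - y‖ ^ (N + 1)) * |(1:ℝ) - 0|) := by
            gcongr
            exact hfac N
      _ = M * ‖y' - y‖ ^ (N + 1) := by simp
      _ ≤ M * ‖y' - y‖ ^ β := by gcongr
      _ ≤ ((N : ℝ) + 2) * M * ‖y' - y‖ ^ β := by nlinarith [(Nat.cast_nonneg N : (0:ℝ) ≤ N)]
  · have hb : ∀ k ≤ N, M * ‖y' - y‖ ^ k ≤ M * ‖y' - y‖ ^ β := by
      intro k hk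
      have : ‖y' - y‖ ^ k ≤ ‖y' - y‖ ^ β := by
        rw [← Real.rpow_natCast]
        have : (k : ℝ) ≤ N := by exact_mod_cast hk
        exact Real.rpow_le_rpow_of_exponent_le h1 (by linarith)
      gcongr
    have h2 : |v y'| ≤ M * ‖y' - y‖ ^ β := by
      have := hM 0 (by omega) y'
      rw [norm_iteratedFDeriv_zero, Real.norm_eq_abs] at this
      have h3 := hb 0 (by omega)
      simp at h3
      linarith
    have h3 : |taylorPoly v N y y'| ≤ (N + 1) * (M * ‖y' - y‖ ^ β) := by
      unfold taylorPoly
      refine (Finset.abs_sum_le_sum_abs _ _).trans ?_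
      have : ∀ k ∈ Finset.range (N + 1),
          |(k.factorial : ℝ)⁻¹ * iteratedFDeriv ℝ k v y (fun _ => y' - y)| ≤ M * ‖y' - y‖ ^ β := by
        intro k hk
        have hk' : k ≤ N := by simpa [Nat.lt_succ_iff] using hk
        rw [abs_mul]
        calc _ ≤ 1 * (M * ‖y' - y‖ ^ k) := by
              gcongr
              · exact hfac k
              · exact hterm k (by omega) y
          _ ≤ _ := by rw [one_mul]; exact hb k hk'
      refine (Finset.sum_le_sum this).trans ?_
      simp
    calc _ ≤ |v y'| + |taylorPoly v N y y'| := abs_sub _ _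
      _ ≤ _ := by nlinarith

lemma taylor_scale {d : ℕ} (v : Euc d → ℝ) (hv : ∀ m : ℕ, ContDiff ℝ m v) (a q : ℝ) (N : ℕ)
    (x x' : Euc d) :
    taylorPoly (fun x => 1 / 2 + a * v (q • x)) N x x' =
      1 / 2 + a * taylorPoly v N (q • x) (q • x') := by
  have hvq : ∀ m : ℕ, ContDiff ℝ m (fun x => v (q • x)) := fun m =>
    (hv m).comp (contDiff_const_smul q)
  have hk : ∀ k : ℕ, iteratedFDeriv ℝ k (fun x => 1 / 2 + a * v (q • x)) x (fun _ => x' - x) =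
      (if k = 0 then 1 / 2 else 0) +
        a * iteratedFDeriv ℝ k v (q • x) (fun _ => q • x' - q • x) := by
    intro k
    have e1 : iteratedFDeriv ℝ k (fun x => 1 / 2 + a * v (q • x)) x =
        iteratedFDeriv ℝ k (fun _ : Euc d => (1 / 2 : ℝ)) x +
          iteratedFDeriv ℝ k (fun x => a • v (q • x)) x := by
      simp only [← smul_eq_mul (a := a)]
      exact iteratedFDeriv_add_apply' contDiffAt_const ((hvq k).const_smul a).contDiffAt
    rw [e1, iteratedFDeriv_const_smul_apply' (hvq k).contDiffAt,
      iteratedFDeriv_comp_const_smul q (hv k)]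
    simp only [ContinuousMultilinearMap.add_apply, ContinuousMultilinearMap.smul_apply, smul_eq_mul]
    congr 1
    · rcases k with _ | k
      · simp
      · simp [iteratedFDeriv_succ_const]
    · congr 1
      rw [← smul_sub]
      have := (iteratedFDeriv ℝ k v (q • x)).map_smul_univ (fun _ => q) (fun _ => x' - x)
      rw [this]
      simp
  unfold taylorPoly
  simp_rw [hk, mul_add, Finset.sum_add_distrib]
  congr 1
  · rw [Finset.sum_eq_single 0] <;> simp
    · intro b _ hb hb'; exact absurd hb' hb
  · rw [Finset.mul_sum]
    refine Finset.sum_congr rfl fun k _ => by ring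

lemma holder_scale {d : ℕ} (β L : ℝ) (hβ : 0 < β) (v : Euc d → ℝ) (M b q : ℝ)
    (hv : ∀ m : ℕ, ContDiff ℝ m v)
    (hM : ∀ j ≤ (⌈β⌉₊ - 1) + 1, ∀ y, ‖iteratedFDeriv ℝ j v y‖ ≤ M) (hq : 0 < q) (hb : 0 ≤ b)
    (hL : b * ((((⌈β⌉₊ - 1 : ℕ) : ℝ) + 2) * M) ≤ L) :
    HolderClass β L (fun x => 1 / 2 + (b * q ^ (-β)) * v (q • x)) := by
  constructor
  · exact contDiff_const.add (contDiff_const.mul ((hv _).comp (contDiff_const_smul q)))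
  · intro x x'
    rw [taylor_scale v hv]
    have h1 := taylor_bound β hβ v M hv hM (q • x) (q • x')
    rw [← smul_sub, norm_smul, Real.norm_eq_abs, abs_of_pos hq,
      Real.mul_rpow hq.le (norm_nonneg _)] at h1
    have hqb : q ^ (-β) * q ^ β = 1 := by
      rw [← Real.rpow_add hq]; simp
    have hq0 : 0 ≤ q ^ (-β) := Real.rpow_nonneg hq.le _
    calc _ = (b * q ^ (-β)) * |v (q • x') - taylorPoly v (⌈β⌉₊ - 1) (q • x) (q • x')| := by
          rw [← abs_of_nonneg (mul_nonneg hb hq0), ← abs_mul, abs_of_nonneg (mul_nonneg hb hq0)]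
          congr 1
          ring
      _ ≤ (b * q ^ (-β)) * ((((⌈β⌉₊ - 1 : ℕ) : ℝ) + 2) * M * (q ^ β * ‖x' - x‖ ^ β)) := by
          gcongr
      _ = (b * ((((⌈β⌉₊ - 1 : ℕ) : ℝ) + 2) * M)) * (q ^ (-β) * q ^ β) * ‖x' - x‖ ^ β := by ring
      _ ≤ _ := by rw [hqb, mul_one]; gcongr

/-- one-dimensional bump. -/
def bmp : ContDiffBump (1 / 4 : ℝ) := ⟨1 / 4, 3 / 8, by norm_num, by norm_num⟩

/-- product bump. -/
def phi (d : ℕ) (y : Euc d) : ℝ := ∏ i, bmp (y i)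

lemma phi_smooth (d : ℕ) (m : ℕ) : ContDiff ℝ m (phi d) := by
  unfold phi
  refine contDiff_prod fun i _ => ?_
  exact bmp.contDiff.comp (by fun_prop)

lemma phi_nonneg {d : ℕ} (y : Euc d) : 0 ≤ phi d y := Finset.prod_nonneg fun i _ => bmp.nonneg
lemma phi_le_one {d : ℕ} (y : Euc d) : phi d y ≤ 1 :=
  Finset.prod_le_one (fun i _ => bmp.nonneg) fun i _ => bmp.le_one

lemma phi_one {d : ℕ} (y : Euc d) (h : ∀ i, y i ∈ Icc (0 : ℝ) (1 / 2)) : phi d y = 1 := by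
  refine Finset.prod_eq_one fun i _ => bmp.one_of_mem_closedBall ?_
  rw [mem_closedBall, Real.dist_eq]
  show |y i - 1 / 4| ≤ 1 / 4
  exact abs_le.2 ⟨by linarith [(h i).1], by linarith [(h i).2]⟩

lemma phi_ne {d : ℕ} (y : Euc d) (h : phi d y ≠ 0) (i) : |y i - 1 / 4| ≤ 3 / 8 := by
  have h1 := Finset.prod_ne_zero_iff.1 h i (Finset.mem_univ i)
  by_contra! hc
  exact h1 (bmp.zero_of_le_dist (by rw [Real.dist_eq]; exact hc.le))

lemma phi_tsupp {d : ℕ} : tsupport (phi d) ⊆ {y | ∀ i, |y i - 1 / 4| ≤ 3 / 8} := by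
  apply closure_minimal
  · intro y hy i
    exact phi_ne y hy i
  · simp only [setOf_forall]
    refine isClosed_iInter fun i => isClosed_le ?_ continuous_const
    fun_prop

lemma phi_compact (d : ℕ) : HasCompactSupport (phi d) := by
  apply HasCompactSupport.of_support_subset_isCompact (K := closedBall 0 (√d * 1))
    (isCompact_closedBall _ _)
  intro y hy
  rw [mem_closedBall_zero_iff, EuclideanSpace.norm_eq]
  have : ∑ i, ‖y i‖ ^ 2 ≤ ∑ i : Fin d, 1 := by
    refine Finset.sum_le_sum fun i _ => ?_
    have := abs_le.1 (phi_ne y hy i)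
    rw [Real.norm_eq_abs, sq_abs]
    nlinarith
  simp at this
  rw [mul_one]
  exact Real.sqrt_le_sqrt (by simpa using this)

lemma phi_bound (d N : ℕ) : ∃ M : ℝ, 0 < M ∧ ∀ j ≤ N, ∀ y, ‖iteratedFDeriv ℝ j (phi d) y‖ ≤ M := by
  have h : ∀ j : ℕ, ∃ C : ℝ, ∀ y, ‖iteratedFDeriv ℝ j (phi d) y‖ ≤ C := fun j =>
    ((phi_smooth d j).continuous_iteratedFDeriv le_rfl).bounded_above_of_compact_support
      ((phi_compact d).iteratedFDeriv j)
  choose C hC using h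
  refine ⟨1 + ∑ j ∈ Finset.range (N + 1), |C j|, by positivity, fun j hj y => ?_⟩
  have := Finset.single_le_sum (f := fun j => |C j|) (fun i _ => abs_nonneg _)
    (Finset.mem_range.2 (Nat.lt_succ_of_le hj))
  have h2 := hC j y
  have h3 := le_abs_self (C j)
  linarith

/-- lattice point. -/
def kv {d q : ℕ} (k : Fin d → Fin q) : Euc d := WithLp.toLp 2 fun i => ((k i : ℕ) : ℝ)

lemma kv_apply {d q : ℕ} (k : Fin d → Fin q) (i) : kv k i = ((k i : ℕ) : ℝ) := rfl

/-- sign -/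
def sg (b : Bool) : ℝ := if b then 1 else -1

/-- sum of signed bumps. -/
def bsum {d q : ℕ} (S : Finset (Fin d → Fin q)) (σ : (Fin d → Fin q) → Bool) (y : Euc d) : ℝ :=
  ∑ k ∈ S, sg (σ k) * phi d (y - kv k)

lemma kv_unique {d q : ℕ} (y : Euc d) (k k' : Fin d → Fin q)
    (h : ∀ i, |(y - kv k) i - 1 / 4| ≤ 3 / 8) (h' : ∀ i, |(y - kv k') i - 1 / 4| ≤ 3 / 8) : k = k' := by
  funext i
  have h1 := abs_le.1 (h i)
  have h2 := abs_le.1 (h' i)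
  simp only [PiLp.sub_apply, kv_apply] at h1 h2
  have a1 : ((k i : ℕ) : ℝ) < ((k' i : ℕ) : ℝ) + 1 := by linarith
  have a2 : ((k' i : ℕ) : ℝ) < ((k i : ℕ) : ℝ) + 1 := by linarith
  have a1' : (k i : ℕ) < k' i + 1 := by exact_mod_cast a1
  have a2' : (k' i : ℕ) < k i + 1 := by exact_mod_cast a2
  exact Fin.ext (by omega)

lemma bsum_smooth {d q : ℕ} (S : Finset (Fin d → Fin q)) (σ) (m : ℕ) : ContDiff ℝ m (bsum S σ) := by
  unfold bsum
  refine ContDiff.sum fun k _ => contDiff_const.mul ?_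
  exact (phi_smooth d m).comp (contDiff_id.sub contDiff_const)

lemma sg_abs (b) : |sg b| = 1 := by unfold sg; split_ifs <;> simp

lemma bsum_bound {d q : ℕ} (S : Finset (Fin d → Fin q)) (σ) (N : ℕ) (M : ℝ) (hM0 : 0 < M)
    (hM : ∀ j ≤ N, ∀ y, ‖iteratedFDeriv ℝ j (phi d) y‖ ≤ M) (j : ℕ) (hj : j ≤ N) (y) :
    ‖iteratedFDeriv ℝ j (bsum S σ) y‖ ≤ M := by
  have hs : ∀ k : Fin d → Fin q, ContDiff ℝ j (fun y => phi d (y - kv k)) := fun k =>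
    (phi_smooth d j).comp (contDiff_id.sub contDiff_const)
  have e : iteratedFDeriv ℝ j (bsum S σ) y =
      ∑ k ∈ S, sg (σ k) • iteratedFDeriv ℝ j (phi d) (y - kv k) := by
    unfold bsum
    rw [iteratedFDeriv_fun_sum_apply fun k _ => (contDiff_const.mul (hs k)).contDiffAt]
    refine Finset.sum_congr rfl fun k _ => ?_
    simp only [← smul_eq_mul (a := sg (σ k))]
    rw [iteratedFDeriv_const_smul_apply' (hs k).contDiffAt, iteratedFDeriv_comp_sub]
  have hz : ∀ k : Fin d → Fin q, iteratedFDeriv ℝ j (phi d) (y - kv k) ≠ 0 →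
      ∀ i, |(y - kv k) i - 1 / 4| ≤ 3 / 8 := by
    intro k hk
    exact phi_tsupp (support_iteratedFDeriv_subset (𝕜 := ℝ) j hk)
  rw [e]
  by_cases hex : ∃ k ∈ S, iteratedFDeriv ℝ j (phi d) (y - kv k) ≠ 0
  · obtain ⟨k, hk, hk0⟩ := hex
    rw [Finset.sum_eq_single_of_mem k hk]
    · rw [norm_smul, Real.norm_eq_abs, sg_abs, one_mul]
      exact hM j hj _
    · intro k' _ hne
      by_contra hc
      have : iteratedFDeriv ℝ j (phi d) (y - kv k') ≠ 0 := fun h0 => hc (by rw [h0, smul_zero])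
      exact hne (kv_unique y k' k (hz k' this) (hz k hk0))
  · push Not at hex
    rw [Finset.sum_eq_zero fun k hk => by rw [hex k hk, smul_zero], norm_zero]
    exact hM0.le

/-- value of `bsum` where the bump `k` is active. -/
lemma bsum_eq {d q : ℕ} (S : Finset (Fin d → Fin q)) (σ) (y : Euc d) (k) (hk : k ∈ S)
    (h : ∀ i, |(y - kv k) i - 1 / 4| ≤ 3 / 8) : bsum S σ y = sg (σ k) * phi d (y - kv k) := by
  unfold bsum
  rw [Finset.sum_eq_single_of_mem k hk]
  intro k' _ hne
  by_contra hc
  exact hne (kv_unique y k' k (phi_ne _ (right_ne_zero_of_mul hc)) h)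

/-- value of `bsum` in an unused cell. -/
lemma bsum_eq_zero {d q : ℕ} (S : Finset (Fin d → Fin q)) (σ) (y : Euc d) (k) (hk : k ∉ S)
    (h : ∀ i, |(y - kv k) i - 1 / 4| ≤ 3 / 8) : bsum S σ y = 0 := by
  unfold bsum
  refine Finset.sum_eq_zero fun k' hk' => ?_
  by_contra hc
  have := kv_unique y k' k (phi_ne _ (right_ne_zero_of_mul hc)) h
  exact hk (this ▸ hk')

lemma bsum_abs {d q : ℕ} (S : Finset (Fin d → Fin q)) (σ) (y : Euc d) : |bsum S σ y| ≤ 1 := by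
  by_cases hex : ∃ k ∈ S, phi d (y - kv k) ≠ 0
  · obtain ⟨k, hk, h⟩ := hex
    rw [bsum_eq S σ y k hk (phi_ne _ h), abs_mul, sg_abs, one_mul, abs_of_nonneg (phi_nonneg _)]
    exact phi_le_one _
  · push Not at hex
    unfold bsum
    rw [Finset.sum_eq_zero fun k hk => by rw [hex k hk, mul_zero]]
    simp

lemma bsum_flip {d q : ℕ} (S : Finset (Fin d → Fin q)) (σ) (k) (y : Euc d) :
    bsum S (flp k σ) y = bsum S σ y ∨
      (bsum S (flp k σ) y = - bsum S σ y ∧ ∀ i, |(y - kv k) i - 1 / 4| ≤ 3 / 8) := by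
  by_cases h : k ∈ S ∧ phi d (y - kv k) ≠ 0
  · right
    have h2 := phi_ne _ h.2
    rw [bsum_eq S _ y k h.1 h2, bsum_eq S _ y k h.1 h2]
    refine ⟨?_, h2⟩
    unfold flp sg
    cases σ k <;> simp
  · left
    unfold bsum
    refine Finset.sum_congr rfl fun k' hk' => ?_
    by_cases e : k' = k
    · subst e
      have : phi d (y - kv k') = 0 := by
        by_contra hc; exact h ⟨hk', hc⟩
      rw [this]; simp
    · simp [flp, Function.update_of_ne e]

lemma volPi {d : ℕ} (s : Fin d → Set ℝ) :
    volume {x : Euc d | ∀ i, x i ∈ s i} = ∏ i, volume (s i) := by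
  have e : {x : Euc d | ∀ i, x i ∈ s i} =
      (MeasurableEquiv.toLp 2 (Fin d → ℝ)).symm ⁻¹' (univ.pi s) := by
    ext x; simp
  rw [e, (EuclideanSpace.volume_preserving_symm_measurableEquiv_toLp (Fin d)).measure_preimage_equiv,
    volume_pi_pi]

/-- one-dimensional support. -/
def TT (q : ℕ) : Set ℝ := ⋃ k : Fin q, Icc (((k : ℕ) : ℝ) / q) ((((k : ℕ) : ℝ) + 1 / 2) / q)

/-- support. -/
def AA (d q : ℕ) : Set (Euc d) := {x | ∀ i, x i ∈ TT q}

/-- cells. -/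
def BB {d q : ℕ} (k : Fin d → Fin q) : Set (Euc d) :=
  {x | ∀ i, x i ∈ Icc (((k i : ℕ) : ℝ) / q) ((((k i : ℕ) : ℝ) + 1 / 2) / q)}

lemma TT_closed (q : ℕ) : IsClosed (TT q) := isClosed_iUnion_of_finite fun _ => isClosed_Icc

lemma TT_sub (q : ℕ) (hq : 1 ≤ q) : TT q ⊆ Icc 0 1 := by
  have hq' : (0 : ℝ) < q := by exact_mod_cast hq
  intro t ht
  simp only [TT, mem_iUnion, mem_Icc] at ht
  obtain ⟨k, h1, h2⟩ := ht
  have hk : ((k : ℕ) : ℝ) + 1 ≤ q := by exact_mod_cast k.2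
  refine ⟨le_trans (by positivity) h1, h2.trans ?_⟩
  rw [div_le_one hq']
  linarith

lemma TT_vol (q : ℕ) (hq : 1 ≤ q) : volume (TT q) = ENNReal.ofReal (1 / 2) := by
  have hq' : (0 : ℝ) < q := by exact_mod_cast hq
  unfold TT
  rw [measure_iUnion]
  · simp only [Real.volume_Icc]
    rw [tsum_fintype, ← ENNReal.ofReal_sum_of_nonneg]
    · congr 1
      have : ∀ k : Fin q, (((k : ℕ) : ℝ) + 1 / 2) / q - ((k : ℕ) : ℝ) / q = 1 / 2 / q := by
        intro k; ring
      simp_rw [this]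
      simp
      field_simp
    · intro k _
      rw [← sub_div]
      apply div_nonneg _ hq'.le
      linarith
  · intro k k' hne
    rw [Function.onFun, Set.disjoint_left]
    rintro t ⟨h1, h2⟩ ⟨h3, h4⟩
    rw [div_le_iff₀ hq'] at h1 h3
    rw [le_div_iff₀ hq'] at h2 h4
    have a1 : ((k : ℕ) : ℝ) < ((k' : ℕ) : ℝ) + 1 := by linarith
    have a2 : ((k' : ℕ) : ℝ) < ((k : ℕ) : ℝ) + 1 := by linarith
    have a1' : (k : ℕ) < k' + 1 := by exact_mod_cast a1
    have a2' : (k' : ℕ) < k + 1 := by exact_mod_cast a2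
    exact hne (Fin.ext (by omega))
  · intro k; exact measurableSet_Icc

lemma interval_sub (a b x l : ℝ) (hx : x ∈ Icc a b) (hl : 0 ≤ l) (hlb : l ≤ b - a) :
    ∃ u, a ≤ u ∧ u + l ≤ b ∧ x - l ≤ u ∧ u ≤ x := by
  refine ⟨max a (x - l), le_max_left _ _, ?_, le_max_right _ _, max_le hx.1 (by linarith)⟩
  rcases max_cases a (x - l) with ⟨h, _⟩ | ⟨h, _⟩ <;> rw [h] <;> linarith [hx.2]

lemma TT_reg (q : ℕ) (hq : 1 ≤ q) (x : ℝ) (hx : x ∈ TT q) (s : ℝ) (hs : 0 < s) (hs1 : s ≤ 1) :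
    ENNReal.ofReal (s / 4) ≤ volume (TT q ∩ Icc (x - s) (x + s)) := by
  have hq' : (0 : ℝ) < q := by exact_mod_cast hq
  rcases le_total s (1 / q) with h | h
  · have hx' := hx
    simp only [TT, mem_iUnion] at hx'
    obtain ⟨k, hk⟩ := hx'
    obtain ⟨u, h1, h2, h3, h4⟩ := interval_sub _ _ x (s / 2) hk (by linarith) (by
      have : (((k : ℕ) : ℝ) + 1 / 2) / q - ((k : ℕ) : ℝ) / q = 1 / q / 2 := by ring
      rw [this]; linarith)
    have hsub : Icc u (u + s / 2) ⊆ TT q ∩ Icc (x - s) (x + s) := by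
      rintro t ⟨t1, t2⟩
      refine ⟨mem_iUnion.2 ⟨k, ⟨by linarith, by linarith⟩⟩, ?_, ?_⟩ <;> linarith
    refine le_trans ?_ (measure_mono hsub)
    rw [Real.volume_Icc]
    exact ENNReal.ofReal_le_ofReal (by linarith)
  · obtain ⟨u, h1, h2, h3, h4⟩ := interval_sub _ _ x (s / 2) (TT_sub q hq hx) (by linarith) (by linarith)
    have hsub : Ico u (u + s / 2) ⊆ (TT q ∩ Icc (x - s) (x + s)) ∪
        (fun t => t + (-(1 / q / 2))) ⁻¹' (TT q ∩ Icc (x - s) (x + s)) := by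
      rintro t ⟨t1, t2⟩
      have ht0 : 0 ≤ (q : ℝ) * t := mul_nonneg hq'.le (by linarith)
      have hf1 := Nat.floor_le ht0
      have hf2 := Nat.lt_floor_add_one ((q : ℝ) * t)
      have hfq : ⌊(q : ℝ) * t⌋₊ < q := by
        rw [Nat.floor_lt ht0]
        nlinarith
      have hqi : (0:ℝ) < 1 / q := by positivity
      rcases le_total ((q : ℝ) * t) (⌊(q : ℝ) * t⌋₊ + 1 / 2) with hc | hc
      · left
        refine ⟨mem_iUnion.2 ⟨⟨_, hfq⟩, ?_, ?_⟩, ?_, ?_⟩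
        · rw [div_le_iff₀ hq']; simp only; linarith
        · rw [le_div_iff₀ hq']; simp only; linarith
        · linarith
        · linarith
      · right
        have e : (q : ℝ) * (t + -(1 / q / 2)) = q * t - 1 / 2 := by field_simp; ring
        refine ⟨mem_iUnion.2 ⟨⟨_, hfq⟩, ?_, ?_⟩, ?_, ?_⟩
        · rw [div_le_iff₀ hq']; simp only; linarith
        · rw [le_div_iff₀ hq']; simp only; linarith
        · simp only; linarith
        · simp only; linarith
    have := (measure_mono (μ := volume) hsub).trans (measure_union_le _ _)
    rw [measure_preimage_add_right, Real.volume_Ico] at this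
    rw [← two_mul] at this
    have e : u + s / 2 - u = 2 * (s / 4) := by ring
    rw [e, ENNReal.ofReal_mul (by norm_num)] at this
    simp only [ENNReal.ofReal_ofNat] at this
    exact (ENNReal.mul_le_mul_iff_right (by norm_num) (by norm_num)).1 this

lemma AA_regular (d q : ℕ) (hd : 1 ≤ d) (hq : 1 ≤ q) :
    Regular ((1 / (8 * √d)) ^ d) 1 (AA d q) := by
  intro x hx r hr hr1
  have hd' : (1 : ℝ) ≤ d := by exact_mod_cast hd
  have hsd : 1 ≤ √(d : ℝ) := Real.one_le_sqrt.2 hd'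
  have hs0 : 0 < r / √d := by positivity
  have hs1 : r / √d ≤ 1 := by rw [div_le_one (by linarith)]; linarith
  have up : volume (closedBall x r) ≤ ENNReal.ofReal (2 * r) ^ d := by
    have : closedBall x r ⊆ {y : Euc d | ∀ i, y i ∈ Icc (x i - r) (x i + r)} := by
      intro y hy i
      rw [mem_closedBall, dist_eq_norm] at hy
      have h1 := (PiLp.norm_apply_le (y - x) i).trans hy
      rw [Real.norm_eq_abs, PiLp.sub_apply] at h1
      have := abs_le.1 h1
      constructor <;> linarith
    refine (measure_mono this).trans ?_
    rw [volPi]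
    simp only [Real.volume_Icc]
    have e : ∀ i, x i + r - (x i - r) = 2 * r := fun i => by ring
    simp [e]
  have lo : ENNReal.ofReal (r / √d / 4) ^ d ≤ volume (AA d q ∩ closedBall x r) := by
    have : {y : Euc d | ∀ i, y i ∈ TT q ∩ Icc (x i - r / √d) (x i + r / √d)} ⊆
        AA d q ∩ closedBall x r := by
      intro y hy
      refine ⟨fun i => (hy i).1, ?_⟩
      rw [mem_closedBall, dist_eq_norm, EuclideanSpace.norm_eq]
      rw [Real.sqrt_le_left hr.le]
      have : ∑ i, ‖(y - x) i‖ ^ 2 ≤ ∑ i : Fin d, (r / √d) ^ 2 := by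
        refine Finset.sum_le_sum fun i _ => ?_
        have h2 := (hy i).2
        rw [PiLp.sub_apply]
        gcongr
        rw [Real.norm_eq_abs]
        exact abs_le.2 ⟨by linarith [h2.1], by linarith [h2.2]⟩
      refine this.trans ?_
      rw [Finset.sum_const, div_pow, Real.sq_sqrt (by linarith)]
      simp
      rw [mul_div_cancel₀ _ (by positivity)]
    refine le_trans ?_ (measure_mono this)
    rw [volPi]
    calc _ = ∏ i : Fin d, ENNReal.ofReal (r / √d / 4) := by simp
      _ ≤ _ := Finset.prod_le_prod' fun i _ => TT_reg q hq (x i) (hx i) _ hs0 hs1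
  refine le_trans ?_ lo
  calc _ ≤ ENNReal.ofReal ((1 / (8 * √d)) ^ d) * ENNReal.ofReal (2 * r) ^ d := by gcongr
    _ = _ := by
      rw [ENNReal.ofReal_pow (by positivity), ← mul_pow, ← ENNReal.ofReal_mul (by positivity)]
      congr 2
      field_simp
      norm_num

lemma AA_closed (d q : ℕ) : IsClosed (AA d q) := by
  have : AA d q = ⋂ i, (fun x : Euc d => x i) ⁻¹' (TT q) := by ext x; simp [AA]
  rw [this]
  exact isClosed_iInter fun i => (TT_closed q).preimage (by fun_prop)

lemma AA_sub (d q : ℕ) (hq : 1 ≤ q) : AA d q ⊆ closedBall 0 (√d) := by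
  intro x hx
  rw [mem_closedBall_zero_iff, EuclideanSpace.norm_eq]
  apply Real.sqrt_le_sqrt
  have : ∑ i, ‖x i‖ ^ 2 ≤ ∑ i : Fin d, (1 : ℝ) := by
    refine Finset.sum_le_sum fun i _ => ?_
    have := TT_sub q hq (hx i)
    rw [Real.norm_eq_abs, sq_abs]
    nlinarith [this.1, this.2]
  simpa using this

lemma AA_compact (d q : ℕ) (hq : 1 ≤ q) : IsCompact (AA d q) :=
  (isCompact_closedBall _ _).of_isClosed_subset (AA_closed d q) (AA_sub d q hq)

lemma BB_meas {d q : ℕ} (k : Fin d → Fin q) : MeasurableSet (BB k) := by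
  have : BB k = ⋂ i, (fun x : Euc d => x i) ⁻¹'
      Icc (((k i : ℕ) : ℝ) / q) ((((k i : ℕ) : ℝ) + 1 / 2) / q) := by ext x; simp [BB]
  rw [this]
  exact (isClosed_iInter fun i => isClosed_Icc.preimage (by fun_prop)).measurableSet

lemma BB_sub {d q : ℕ} (k : Fin d → Fin q) : BB k ⊆ AA d q := fun _ hx i =>
  mem_iUnion.2 ⟨k i, hx i⟩

lemma AA_exists {d q : ℕ} {x : Euc d} (hx : x ∈ AA d q) : ∃ k : Fin d → Fin q, x ∈ BB k := by
  have : ∀ i, ∃ j : Fin q, x i ∈ Icc (((j : ℕ) : ℝ) / q) ((((j : ℕ) : ℝ) + 1 / 2) / q) :=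
    fun i => mem_iUnion.1 (hx i)
  choose k hk using this
  exact ⟨k, hk⟩

lemma BB_scaled {d q : ℕ} (hq : 1 ≤ q) {k : Fin d → Fin q} {x : Euc d} (hx : x ∈ BB k) (i) :
    ((q : ℝ) • x - kv k) i ∈ Icc (0 : ℝ) (1 / 2) := by
  have hq' : (0 : ℝ) < q := by exact_mod_cast hq
  have := hx i
  rw [mem_Icc, div_le_iff₀ hq', le_div_iff₀ hq'] at this
  simp only [PiLp.sub_apply, PiLp.smul_apply, kv_apply, smul_eq_mul]
  constructor <;> linarith [this.1, this.2]

lemma BB_scaled' {d q : ℕ} (hq : 1 ≤ q) {k : Fin d → Fin q} {x : Euc d} (hx : x ∈ BB k) (i) :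
    |((q : ℝ) • x - kv k) i - 1 / 4| ≤ 3 / 8 := by
  have := BB_scaled hq hx i
  exact abs_le.2 ⟨by linarith [this.1], by linarith [this.2]⟩

lemma BB_disj {d q : ℕ} (hq : 1 ≤ q) : Pairwise (Function.onFun Disjoint (BB (d := d) (q := q))) := by
  intro k k' hne
  rw [Function.onFun, Set.disjoint_left]
  intro x h1 h2
  exact hne (kv_unique _ k k' (BB_scaled' hq h1) (BB_scaled' hq h2))

/-- density. -/
def mu (d q : ℕ) (x : Euc d) : ℝ := (AA d q).indicator (fun _ => (2 : ℝ) ^ d) x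

/-- marginal. -/
def PXq (d q : ℕ) : Measure (Euc d) := volume.withDensity fun x => ENNReal.ofReal (mu d q x)

lemma PXq_apply (d q : ℕ) (s : Set (Euc d)) (hs : MeasurableSet s) :
    PXq d q s = 2 ^ d * volume (AA d q ∩ s) := by
  have hA := (AA_closed d q).measurableSet
  unfold PXq
  have : (fun x => ENNReal.ofReal (mu d q x)) = (AA d q).indicator (fun _ => (2 : ℝ≥0∞) ^ d) := by
    funext x
    unfold mu
    by_cases h : x ∈ AA d q
    · simp only [indicator_of_mem h]
      rw [ENNReal.ofReal_pow (by norm_num)]; simp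
    · simp [indicator_of_notMem h]
  rw [withDensity_apply _ hs, this, lintegral_indicator hA, lintegral_const,
    Measure.restrict_restrict hA, Measure.restrict_apply_univ]

lemma PXq_prob (d q : ℕ) (hq : 1 ≤ q) : IsProbabilityMeasure (PXq d q) := by
  constructor
  rw [PXq_apply d q _ MeasurableSet.univ, inter_univ]
  unfold AA
  rw [volPi]
  simp only [TT_vol q hq, Finset.prod_const, Finset.card_univ, Fintype.card_fin]
  rw [← mul_pow]
  have : (2 : ℝ≥0∞) * ENNReal.ofReal (1 / 2) = 1 := by
    rw [show (2 : ℝ≥0∞) = ENNReal.ofReal 2 by simp, ← ENNReal.ofReal_mul (by norm_num)]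
    norm_num
  rw [this, one_pow]

lemma PXq_BB (d q : ℕ) (hq : 1 ≤ q) (k : Fin d → Fin q) :
    (PXq d q).real (BB k) = ((q : ℝ)⁻¹) ^ d := by
  have hq' : (0 : ℝ) < q := by exact_mod_cast hq
  rw [measureReal_def, PXq_apply d q _ (BB_meas k), inter_eq_right.2 (BB_sub k)]
  unfold BB
  rw [volPi]
  simp only [Real.volume_Icc]
  have : ∀ i, (((k i : ℕ) : ℝ) + 1 / 2) / q - ((k i : ℕ) : ℝ) / q = 1 / 2 / q := by
    intro i; ring
  simp_rw [this]
  simp only [Finset.prod_const, Finset.card_univ, Fintype.card_fin]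
  rw [← mul_pow, ENNReal.toReal_pow, ENNReal.toReal_mul, ENNReal.toReal_ofReal (by positivity)]
  congr 1
  simp
  field_simp

lemma PXq_compl (d q : ℕ) : PXq d q (AA d q)ᶜ = 0 := by
  rw [PXq_apply d q _ (AA_closed d q).measurableSet.compl]
  simp

lemma PXq_strong (d q : ℕ) (hd : 1 ≤ d) (hq : 1 ≤ q) :
    StrongDensity (PXq d q) ((1 / (8 * √d)) ^ d) 1 (2 ^ d) (2 ^ d + 1) (closedBall 0 (√d)) := by
  refine ⟨AA d q, AA_compact d q hq, AA_sub d q hq, AA_regular d q hd hq, mu d q, ?_, ?_, ?_, rfl⟩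
  · exact measurable_const.indicator (AA_closed d q).measurableSet
  · intro x hx
    simp [mu, hx]
  · intro x hx
    simp [mu, hx]

lemma choice_qm (d : ℕ) (α β : ℝ) (hα : 0 < α) (hβ : 0 < β) (hαβ : α * β ≤ (d : ℝ)) (n : ℕ)
    (hn : 1 ≤ n) : ∃ q m : ℕ, 1 ≤ q ∧ (n : ℝ) ≤ (q : ℝ) ^ (2 * β + d) ∧ m ≤ q ^ d ∧
      (m : ℝ) ≤ (q : ℝ) ^ (d - α * β) ∧ (q : ℝ) ^ (d - α * β) / 2 ≤ m ∧
      (2 : ℝ) ^ (-(β * (1 + α))) * (n : ℝ) ^ (-(β * (1 + α)) / (2 * β + d)) ≤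
        (q : ℝ) ^ (-(β * (1 + α))) := by
  have hD : 0 < 2 * β + d := by positivity
  have hn1 : (1 : ℝ) ≤ n := by exact_mod_cast hn
  set r : ℝ := (n : ℝ) ^ (1 / (2 * β + d)) with hr
  have hr1 : 1 ≤ r := Real.one_le_rpow hn1 (by positivity)
  set q := ⌈r⌉₊ with hqd
  have hq1r : r ≤ q := Nat.le_ceil r
  have hq1 : (1 : ℝ) ≤ q := hr1.trans hq1r
  have hq0 : (0 : ℝ) < q := by linarith
  have hq2 : (q : ℝ) ≤ 2 * r := by
    have := (Nat.ceil_lt_add_one (by linarith : 0 ≤ r)).le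
    linarith
  set s : ℝ := (q : ℝ) ^ (d - α * β) with hs
  have hs1 : 1 ≤ s := Real.one_le_rpow hq1 (by linarith)
  refine ⟨q, ⌊s⌋₊, by exact_mod_cast hq1, ?_, ?_, Nat.floor_le (by linarith), ?_, ?_⟩
  · calc (n : ℝ) = r ^ (2 * β + d) := by
          rw [hr, ← Real.rpow_mul (by positivity), one_div, inv_mul_cancel₀ hD.ne', Real.rpow_one]
      _ ≤ _ := Real.rpow_le_rpow (by linarith) hq1r hD.le
  · have : (⌊s⌋₊ : ℝ) ≤ (q : ℝ) ^ d := by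
      refine (Nat.floor_le (by linarith)).trans ?_
      rw [hs, ← Real.rpow_natCast]
      exact Real.rpow_le_rpow_of_exponent_le hq1 (by nlinarith)
    exact_mod_cast this
  · have h1 : s < ⌊s⌋₊ + 1 := Nat.lt_floor_add_one s
    have h2 : (1 : ℝ) ≤ ⌊s⌋₊ := by exact_mod_cast Nat.le_floor (by simpa using hs1)
    linarith
  · calc (2 : ℝ) ^ (-(β * (1 + α))) * (n : ℝ) ^ (-(β * (1 + α)) / (2 * β + d))
        = (2 * r) ^ (-(β * (1 + α))) := by
          rw [Real.mul_rpow (by norm_num) (by linarith), hr, ← Real.rpow_mul (by positivity)]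
          congr 2; ring
      _ ≤ _ := Real.rpow_le_rpow_of_nonpos hq0 hq2 (by
          have : 0 < β * (1 + α) := by positivity
          linarith)

/-- regression functions of the construction. -/
def etaq {d q : ℕ} (a : ℝ) (S : Finset (Fin d → Fin q)) (σ : (Fin d → Fin q) → Bool) (x : Euc d) : ℝ :=
  1 / 2 + a * bsum S σ ((q : ℝ) • x)

lemma etaq_meas {d q : ℕ} (a : ℝ) (S : Finset (Fin d → Fin q)) (σ) : Measurable (etaq a S σ) := by
  have h := (bsum_smooth S σ 0).continuous
  have : Continuous (etaq a S σ) := by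
    unfold etaq
    exact continuous_const.add (continuous_const.mul (h.comp (continuous_const_smul _)))
  exact this.measurable

lemma etaq_abs {d q : ℕ} {a : ℝ} (ha : 0 < a) (S : Finset (Fin d → Fin q)) (σ) (x) :
    |etaq a S σ x - 1 / 2| ≤ a := by
  unfold etaq
  rw [add_sub_cancel_left, abs_mul, abs_of_pos ha]
  exact mul_le_of_le_one_right ha.le (bsum_abs _ _ _)

lemma etaq_in {d q : ℕ} (hq : 1 ≤ q) (a : ℝ) (S : Finset (Fin d → Fin q)) (σ) (k) (hk : k ∈ S) (x)
    (hx : x ∈ BB k) : etaq a S σ x = 1 / 2 + if σ k then a else -a := by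
  unfold etaq
  rw [bsum_eq S σ _ k hk (BB_scaled' hq hx), phi_one _ (BB_scaled hq hx)]
  unfold sg
  split_ifs <;> simp

lemma etaq_out {d q : ℕ} (hq : 1 ≤ q) (a : ℝ) (S : Finset (Fin d → Fin q)) (σ) (k) (hk : k ∉ S) (x)
    (hx : x ∈ BB k) : etaq a S σ x = 1 / 2 := by
  unfold etaq
  rw [bsum_eq_zero S σ _ k hk (BB_scaled' hq hx)]
  simp

lemma PXq_mono {d q : ℕ} {s t : Set (Euc d)} (h : s ∩ AA d q ⊆ t) : PXq d q s ≤ PXq d q t := by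
  refine measure_mono_ae ?_
  have : ∀ᵐ x ∂PXq d q, x ∈ AA d q := PXq_compl d q
  filter_upwards [this] with x hx hs using h ⟨hs, hx⟩

lemma etaq_margin {d q : ℕ} (hq : 1 ≤ q) {a α C0 : ℝ} (ha : 0 < a) (hα : 0 < α) (hC : 0 ≤ C0)
    (S : Finset (Fin d → Fin q)) (σ)
    (h : (S.card : ℝ) * ((q : ℝ)⁻¹) ^ d ≤ C0 * a ^ α) : Margin (PXq d q) (etaq a S σ) α C0 := by
  haveI := PXq_prob d q hq
  intro t ht
  by_cases hta : a ≤ t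
  · calc _ ≤ PXq d q (⋃ k ∈ S, BB k) := by
          apply PXq_mono
          rintro x ⟨⟨h1, _⟩, hx⟩
          obtain ⟨k, hk⟩ := AA_exists hx
          by_cases hkS : k ∈ S
          · exact mem_biUnion hkS hk
          · rw [etaq_out hq a S σ k hkS x hk] at h1
            simp at h1
      _ ≤ ∑ k ∈ S, PXq d q (BB k) := measure_biUnion_finset_le _ _
      _ = ∑ k ∈ S, ENNReal.ofReal (((q : ℝ)⁻¹) ^ d) := by
          refine Finset.sum_congr rfl fun k _ => ?_
          rw [← PXq_BB d q hq k, ofReal_measureReal]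
      _ = ENNReal.ofReal ((S.card : ℝ) * ((q : ℝ)⁻¹) ^ d) := by
          rw [Finset.sum_const, nsmul_eq_mul, ENNReal.ofReal_mul (by positivity),
            ENNReal.ofReal_natCast]
      _ ≤ _ := by
          refine ENNReal.ofReal_le_ofReal (h.trans ?_)
          exact mul_le_mul_of_nonneg_left (Real.rpow_le_rpow ha.le hta hα.le) hC
  · have : PXq d q {x | 0 < |etaq a S σ x - 1 / 2| ∧ |etaq a S σ x - 1 / 2| ≤ t} ≤ PXq d q ∅ := by
      apply PXq_mono
      rintro x ⟨⟨h1, h2⟩, hx⟩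
      obtain ⟨k, hk⟩ := AA_exists hx
      by_cases hkS : k ∈ S
      · rw [etaq_in hq a S σ k hkS x hk, add_sub_cancel_left] at h2
        have : |if σ k then a else -a| = a := by
          split_ifs <;> simp [abs_of_pos ha]
        linarith
      · rw [etaq_out hq a S σ k hkS x hk] at h1
        simp at h1
    rw [measure_empty] at this
    exact this.trans (by simp)

lemma etaq_diff {d q : ℕ} (hq : 1 ≤ q) (a : ℝ) (S : Finset (Fin d → Fin q)) (σ) (k) :
    (PXq d q).real {x | etaq a S σ x ≠ etaq a S (flp k σ) x} ≤ ((q : ℝ)⁻¹) ^ d := by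
  haveI := PXq_prob d q hq
  rw [← PXq_BB d q hq k]
  refine ENNReal.toReal_mono (measure_ne_top _ _) (PXq_mono ?_)
  rintro x ⟨h1, hx⟩
  obtain ⟨k', hk'⟩ := AA_exists hx
  rcases bsum_flip S σ k ((q : ℝ) • x) with h | ⟨_, h⟩
  · exact absurd (by unfold etaq; rw [h]) h1
  · rwa [kv_unique _ k k' h (BB_scaled' hq hk')]

theorem stmt7_aux (d : ℕ) (hd : 1 ≤ d) (α β L : ℝ) (hα : 0 < α) (hβ : 0 < β) (hL : 0 < L)
    (hαβ : α * β ≤ (d : ℝ)) :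
    ∃ (C0 c0 r0 μmin μmax : ℝ) (K : Set (Euc d)) (C : ℝ),
      0 < C0 ∧ 0 < c0 ∧ 0 < r0 ∧ 0 < μmin ∧ μmin < μmax ∧ IsCompact K ∧ 0 < C ∧
      ∀ (n : ℕ), 1 ≤ n → ∀ fhat : Sample d n → Euc d → Bool,
        Measurable (Function.uncurry fhat) →
        ∃ (PX : Measure (Euc d)) (η : Euc d → ℝ),
          MemPS α C0 β L c0 r0 μmin μmax K PX η ∧
          C * (n : ℝ) ^ (-(β * (1 + α)) / (2 * β + d)) ≤ expExcessRule PX η fhat := by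
  obtain ⟨M, hM0, hM⟩ := phi_bound d ((⌈β⌉₊ - 1) + 1)
  have hD : 0 < (((⌈β⌉₊ - 1 : ℕ) : ℝ) + 2) * M := by positivity
  obtain ⟨b, hb0, hb4, hbL⟩ : ∃ b : ℝ, 0 < b ∧ b ≤ 1 / 4 ∧
      b * ((((⌈β⌉₊ - 1 : ℕ) : ℝ) + 2) * M) ≤ L :=
    ⟨min (1 / 4) (L / ((((⌈β⌉₊ - 1 : ℕ) : ℝ) + 2) * M)), by positivity, min_le_left _ _,
      (le_div_iff₀ hD).1 (min_le_right _ _)⟩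
  have hd0 : (0 : ℝ) < d := by exact_mod_cast hd
  refine ⟨b ^ (-α), (1 / (8 * √d)) ^ d, 1, 2 ^ d, 2 ^ d + 1, closedBall 0 (√d),
    b / 8 * 2 ^ (-(β * (1 + α))), by positivity, by positivity, one_pos, by positivity,
    by linarith, isCompact_closedBall _ _, by positivity, ?_⟩
  intro n hn fhat hf
  obtain ⟨q, m, hq, hnq, hmq, hm1, hm2, hfin⟩ := choice_qm d α β hα hβ hαβ n hn
  have hq1 : (1 : ℝ) ≤ q := by exact_mod_cast hq
  have hq0 : (0 : ℝ) < q := by linarith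
  obtain ⟨S, -, hS⟩ := Finset.exists_subset_card_eq
    (s := (Finset.univ : Finset (Fin d → Fin q))) (n := m) (by simpa using hmq)
  haveI := PXq_prob d q hq
  set a : ℝ := b * (q : ℝ) ^ (-β) with ha
  have ha0 : 0 < a := by positivity
  have ha4 : a ≤ 1 / 4 := by
    have : (q : ℝ) ^ (-β) ≤ 1 := Real.rpow_le_one_of_one_le_of_nonpos hq1 (by linarith)
    calc a ≤ b * 1 := mul_le_mul_of_nonneg_left this hb0.le
      _ ≤ _ := by linarith
  have hw : ((q : ℝ)⁻¹) ^ d = (q : ℝ) ^ (-(d : ℝ)) := by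
    rw [Real.rpow_neg hq0.le, Real.rpow_natCast, inv_pow]
  have hna : a ^ 2 * ((q : ℝ)⁻¹) ^ d * n ≤ 1 / 16 := by
    calc a ^ 2 * ((q : ℝ)⁻¹) ^ d * n ≤ a ^ 2 * ((q : ℝ)⁻¹) ^ d * (q : ℝ) ^ (2 * β + d) := by
          gcongr
      _ = b ^ 2 * ((q : ℝ) ^ (-β) * (q : ℝ) ^ (-β) * (q : ℝ) ^ (-(d : ℝ)) *
            (q : ℝ) ^ (2 * β + d)) := by rw [ha, hw]; ring
      _ = b ^ 2 := by
          rw [← Real.rpow_add hq0, ← Real.rpow_add hq0, ← Real.rpow_add hq0]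
          have : -β + -β + -(d : ℝ) + (2 * β + d) = 0 := by ring
          rw [this, Real.rpow_zero, mul_one]
      _ ≤ 1 / 16 := by nlinarith
  obtain ⟨σ, hσ⟩ := assouad (PXq d q) S BB BB_meas (BB_disj hq) (etaq a S) (etaq_meas a S) a
    (((q : ℝ)⁻¹) ^ d) ha0 ha4 (etaq_abs ha0 S) (fun σ k hk x hx => etaq_in hq a S σ k hk x hx)
    (fun σ k x => by
      rcases bsum_flip S σ k ((q : ℝ) • x) with h | ⟨h, _⟩
      · left; unfold etaq; rw [h]
      · right; unfold etaq; rw [h]; ring)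
    (etaq_diff hq a S) (PXq_BB d q hq) hna fhat hf
  refine ⟨PXq d q, etaq a S σ, ⟨inferInstance, etaq_meas a S σ, ?_, ?_, ?_, PXq_strong d q hd hq⟩,
    le_trans ?_ hσ⟩
  · intro x
    have := abs_le.1 (etaq_abs ha0 S σ x)
    exact ⟨by linarith [this.1], by linarith [this.2]⟩
  · refine etaq_margin hq ha0 hα (by positivity) S σ ?_
    rw [hS]
    calc (m : ℝ) * ((q : ℝ)⁻¹) ^ d ≤ (q : ℝ) ^ (d - α * β) * ((q : ℝ)⁻¹) ^ d := by gcongr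
      _ = (q : ℝ) ^ (-(α * β)) := by
          rw [hw, ← Real.rpow_add hq0]; congr 1; ring
      _ = b ^ (-α) * a ^ α := by
          rw [ha, Real.mul_rpow hb0.le (by positivity), ← mul_assoc, ← Real.rpow_add hb0,
            neg_add_cancel, Real.rpow_zero, one_mul, ← Real.rpow_mul hq0.le]
          congr 1; ring
      _ ≤ _ := le_rfl
  · exact holder_scale β L hβ (bsum S σ) M b q (bsum_smooth S σ)
      (fun j hj y => bsum_bound S σ _ M hM0 hM j hj y) hq0 hb0.le hbL
  · rw [hS]
    calc b / 8 * 2 ^ (-(β * (1 + α))) * (n : ℝ) ^ (-(β * (1 + α)) / (2 * β + d))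
        ≤ b / 8 * (q : ℝ) ^ (-(β * (1 + α))) := by
          rw [mul_assoc]; exact mul_le_mul_of_nonneg_left hfin (by positivity)
      _ = (q : ℝ) ^ (d - α * β) / 2 * ((q : ℝ)⁻¹) ^ d * a / 4 := by
          have : (q : ℝ) ^ (-(β * (1 + α))) =
              (q : ℝ) ^ (d - α * β) * (q : ℝ) ^ (-(d : ℝ)) * (q : ℝ) ^ (-β) := by
            rw [← Real.rpow_add hq0, ← Real.rpow_add hq0]; congr 1; ring
          rw [this, hw, ha]; ring
      _ ≤ _ := by gcongr

/-- Theorem 3.5, minimax lower bound under the strong density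
assumption. If `αβ ≤ d` then, for suitable parameters, no classifier can beat the rate
`n^{-β(1+α)/(2β+d)}` uniformly over `P_Σ`. -/
theorem stmt7 (d : ℕ) (hd : 1 ≤ d) (α β L : ℝ) (hα : 0 < α) (hβ : 0 < β) (hL : 0 < L)
    (hαβ : α * β ≤ (d : ℝ)) :
    ∃ (C0 c0 r0 μmin μmax : ℝ) (K : Set (Euc d)) (C : ℝ),
      0 < C0 ∧ 0 < c0 ∧ 0 < r0 ∧ 0 < μmin ∧ μmin < μmax ∧ IsCompact K ∧ 0 < C ∧
      ∀ (n : ℕ), 1 ≤ n → ∀ fhat : Sample d n → Euc d → Bool,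
        Measurable (Function.uncurry fhat) →
        ∃ (PX : Measure (Euc d)) (η : Euc d → ℝ),
          MemPS α C0 β L c0 r0 μmin μmax K PX η ∧
          C * (n : ℝ) ^ (-(β * (1 + α)) / (2 * β + d)) ≤ expExcessRule PX η fhat := by
  exact stmt7_aux d hd α β L hα hβ hL hαβ

end
end
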